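/- arXiv:2009.05691 — 4 statements merged into one kernel-verified Lean document; each statement's English description precedes it below -/
import Mathlib

section
/- Let G be a graph that contains a long theta. Then G contains a long even hole (an even hole of length at least ℓ). -/
open SimpleGraph

namespace LEH

open scoped Classical

variable {V : Type*}

/-- `X` is anticomplete to `Y`: they are disjoint and there are no edges between them. -/
def Anticomplete (G : SimpleGraph V) (X Y : Set V) : Prop :=
  ∀ ⦃x⦄, x ∈ X → ∀ ⦃y⦄, y ∈ Y → x ≠ y ∧ ¬ G.Adj x y

/-- The vertex set of a walk. -/
def vset {G : SimpleGraph V} {u v : V} (P : G.Walk u v) : Set V :=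
  {x | x ∈ P.support}

/-- The interior of a path: its non-end vertices. -/
def inter {G : SimpleGraph V} {u v : V} (P : G.Walk u v) : Set V :=
  {x | x ∈ P.support ∧ x ≠ u ∧ x ≠ v}

/-- An induced path in `G`. -/
def IsInducedPath {G : SimpleGraph V} {u v : V} (P : G.Walk u v) : Prop :=
  P.IsPath ∧ ∀ x ∈ P.support, ∀ y ∈ P.support, G.Adj x y → s(x, y) ∈ P.edges

/-- A hole: an induced cycle of length at least 4. -/
def IsHole {G : SimpleGraph V} {u : V} (c : G.Walk u u) : Prop :=
  c.IsCycle ∧ 4 ≤ c.length ∧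
    ∀ x ∈ c.support, ∀ y ∈ c.support, G.Adj x y → s(x, y) ∈ c.edges

/-- A long even hole: a hole of even length at least `ℓ`. -/
def IsLongEvenHole (ℓ : ℕ) {G : SimpleGraph V} {u : V} (c : G.Walk u u) : Prop :=
  IsHole c ∧ ℓ ≤ c.length ∧ Even c.length

def HasLongEvenHole (G : SimpleGraph V) (ℓ : ℕ) : Prop :=
  ∃ (u : V) (c : G.Walk u u), IsLongEvenHole ℓ c

/-- A long theta in `G`: two nonadjacent vertices joined by three internally disjoint
induced paths with no edges between their interiors, any two of which form a long hole. -/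
def HasLongTheta (G : SimpleGraph V) (ℓ : ℕ) : Prop :=
  ∃ (u v : V) (P₁ P₂ P₃ : G.Walk u v),
    u ≠ v ∧ ¬ G.Adj u v ∧
    IsInducedPath P₁ ∧ IsInducedPath P₂ ∧ IsInducedPath P₃ ∧
    Anticomplete G (inter P₁) (inter P₂) ∧
    Anticomplete G (inter P₁) (inter P₃) ∧
    Anticomplete G (inter P₂) (inter P₃) ∧
    ℓ ≤ P₁.length + P₂.length ∧ ℓ ≤ P₁.length + P₃.length ∧
    ℓ ≤ P₂.length + P₃.length

/-- A long jewel of order `k` formed by `Q₁, Q₂, P`. -/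
def IsLongJewel (ℓ k : ℕ) {G : SimpleGraph V} {u v : V}
    (Q₁ Q₂ P : G.Walk u v) : Prop :=
  u ≠ v ∧
  IsInducedPath Q₁ ∧ IsInducedPath Q₂ ∧ IsInducedPath P ∧
  ¬ (Even Q₁.length ↔ Even Q₂.length) ∧
  max Q₁.support.length Q₂.support.length = k ∧
  ℓ ≤ P.length + min Q₁.length Q₂.length ∧
  Anticomplete G (inter P) (inter Q₁ ∪ inter Q₂)

def HasLongJewel (G : SimpleGraph V) (ℓ k : ℕ) : Prop :=
  ∃ (u v : V) (Q₁ Q₂ P : G.Walk u v), IsLongJewel ℓ k Q₁ Q₂ P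

/-- A long ban-the-bomb in `G`. -/
def IsLongBanTheBomb (ℓ : ℕ) {G : SimpleGraph V} (u v₁ w v₂ x : V)
    (P₁ : G.Walk x v₁) (P₂ : G.Walk x v₂) : Prop :=
  G.Adj u v₁ ∧ G.Adj v₁ w ∧ G.Adj w v₂ ∧ G.Adj v₂ u ∧ ¬ G.Adj v₁ v₂ ∧ u ≠ w ∧
  G.Adj x u ∧ ¬ G.Adj x v₁ ∧ ¬ G.Adj x v₂ ∧ ¬ G.Adj x w ∧
  x ≠ v₁ ∧ x ≠ v₂ ∧ x ≠ w ∧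
  IsInducedPath P₁ ∧ IsInducedPath P₂ ∧
  2 ≤ P₁.length ∧ 2 ≤ P₂.length ∧
  Anticomplete G (inter P₁) {u, w} ∧ Anticomplete G (inter P₂) {u, w} ∧
  Anticomplete G (vset P₁ \ {x}) (vset P₂ \ {x}) ∧
  ℓ ≤ P₁.length + 2 ∧ ℓ ≤ P₂.length + 2 ∧ ℓ ≤ P₁.length + P₂.length + 2

def HasLongBanTheBomb (G : SimpleGraph V) (ℓ : ℕ) : Prop :=
  ∃ (u v₁ w v₂ x : V) (P₁ : G.Walk x v₁) (P₂ : G.Walk x v₂),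
    IsLongBanTheBomb ℓ u v₁ w v₂ x P₁ P₂

/-- The induced subgraph of `G` on the vertex set `S` is a long hole. -/
def IsLongHoleOn (G : SimpleGraph V) (ℓ : ℕ) (S : Set V) : Prop :=
  ∃ (u : V) (c : G.Walk u u), IsHole c ∧ ℓ ≤ c.length ∧ {x | x ∈ c.support} = S

/-- A long near-prism with triangles `{a 0, a 1, a 2}`, `{b 0, b 1, b 2}` and
constituent paths `P 0, P 1, P 2`. -/
def IsLongNearPrism (ℓ : ℕ) {G : SimpleGraph V} (a b : Fin 3 → V)
    (P : ∀ i : Fin 3, G.Walk (a i) (b i)) : Prop :=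
  (∀ i j, i ≠ j → G.Adj (a i) (a j)) ∧
  (∀ i j, i ≠ j → G.Adj (b i) (b j)) ∧
  (Set.range a ∩ Set.range b).Subsingleton ∧
  (∀ i, (P i).IsPath) ∧
  (∀ i j, i ≠ j → ∀ x, x ∈ (P i).support → x ∉ (P j).support) ∧
  (∀ i j, i ≠ j → IsLongHoleOn G ℓ (vset (P i) ∪ vset (P j)))

def HasLongNearPrism (G : SimpleGraph V) (ℓ : ℕ) : Prop :=
  ∃ (a b : Fin 3 → V) (P : ∀ i : Fin 3, G.Walk (a i) (b i)), IsLongNearPrism ℓ a b P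

/-- A prospect: no long even hole of length at most `2ℓ`, no long jewel of order at most
`ℓ+1`, no long theta and no long ban-the-bomb. -/
def Prospect (G : SimpleGraph V) (ℓ : ℕ) : Prop :=
  (¬ ∃ (u : V) (c : G.Walk u u), IsLongEvenHole ℓ c ∧ c.length ≤ 2 * ℓ) ∧
  (¬ ∃ k ≤ ℓ + 1, HasLongJewel G ℓ k) ∧
  ¬ HasLongTheta G ℓ ∧ ¬ HasLongBanTheBomb G ℓ

/-- A candidate : a prospect with no long near-prism. -/
def Candidate (G : SimpleGraph V) (ℓ : ℕ) : Prop :=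
  Prospect G ℓ ∧ ¬ HasLongNearPrism G ℓ

/-- The vertex set of a near-prism. -/
def prismSupport {G : SimpleGraph V} {a b : Fin 3 → V}
    (P : ∀ i : Fin 3, G.Walk (a i) (b i)) : Set V :=
  ⋃ i, vset (P i)

/-- The near-prism, as a graph on `V`. -/
def prismGraph (G : SimpleGraph V) (a b : Fin 3 → V)
    (P : ∀ i : Fin 3, G.Walk (a i) (b i)) : SimpleGraph V :=
  SimpleGraph.fromEdgeSet
    ({e | ∃ i j, i ≠ j ∧ e = s(a i, a j)} ∪ {e | ∃ i j, i ≠ j ∧ e = s(b i, b j)} ∪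
      {e | ∃ i, e ∈ (P i).edges})

/-- `q` is `K`-major: `q` is outside the near-prism `K`, and no path of `K` with at most
three vertices contains all neighbours of `q` in `V(K)`. -/
def KMajor (G : SimpleGraph V) {a b : Fin 3 → V}
    (P : ∀ i : Fin 3, G.Walk (a i) (b i)) (q : V) : Prop :=
  q ∉ prismSupport P ∧
  ¬ ∃ (x y : V) (W : (prismGraph G a b P).Walk x y), W.IsPath ∧ W.length ≤ 2 ∧
      ∀ z ∈ prismSupport P, G.Adj q z → z ∈ W.support

/-- A shortest long near-prism. -/
def ShortestLNP (G : SimpleGraph V) (ℓ : ℕ) {a b : Fin 3 → V}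
    (P : ∀ i : Fin 3, G.Walk (a i) (b i)) : Prop :=
  IsLongNearPrism ℓ a b P ∧
  ∀ (a' b' : Fin 3 → V) (P' : ∀ i : Fin 3, G.Walk (a' i) (b' i)),
    IsLongNearPrism ℓ a' b' P' → (prismSupport P).ncard ≤ (prismSupport P').ncard

/-- The interior `F_K*` of the frame of a long near-prism: for each constituent path,
either the whole path (if it has length at most `ℓ-1`), or the non-end vertices of the
two stubs of length `ℓ/2 - 1` at its two ends. -/
def frameStar (ℓ : ℕ) {G : SimpleGraph V} {a b : Fin 3 → V}
    (P : ∀ i : Fin 3, G.Walk (a i) (b i)) : Set V :=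
  ⋃ i,
    if (P i).length ≤ ℓ - 1 then vset (P i)
    else {x | x ∈ (P i).support.take (ℓ / 2 - 1)} ∪
      {x | x ∈ (P i).support.reverse.take (ℓ / 2 - 1)}

/-- A long near-prism is tidy: it contains a frame (so at most one constituent path has
length at most `ℓ-1`) whose interior is anticomplete to the rest of the graph. -/
def Tidy (G : SimpleGraph V) (ℓ : ℕ) {a b : Fin 3 → V}
    (P : ∀ i : Fin 3, G.Walk (a i) (b i)) : Prop :=
  (∀ i j, (P i).length ≤ ℓ - 1 → (P j).length ≤ ℓ - 1 → i = j) ∧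
  Anticomplete G (frameStar ℓ P) {x | x ∉ prismSupport P}

/-- The index of the first neighbour of `x` in the list `l`. -/
noncomputable def firstNbrIdx (G : SimpleGraph V) (l : List V) (x : V) : ℕ :=
  l.findIdx (fun y => decide (G.Adj x y))

/-- `α(x)`: the neighbour of `x` on `P` nearest to the first end of `P`. -/
noncomputable def alpha (G : SimpleGraph V) {u w : V} (P : G.Walk u w) (x : V) : V :=
  P.support.getD (firstNbrIdx G P.support x) u

/-- `β(x)`: the neighbour of `x` on `P` nearest to the last end of `P`. -/
noncomputable def beta (G : SimpleGraph V) {u w : V} (P : G.Walk u w) (x : V) : V :=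
  P.support.reverse.getD (firstNbrIdx G P.support.reverse x) w

/-- `A(x)`: the vertex set of the subpath of `P` from its first end to `α(x)` if `x` has
a neighbour on `P`, and all of `V(P)` otherwise. -/
noncomputable def Aset (G : SimpleGraph V) {u w : V} (P : G.Walk u w) (x : V) : Set V :=
  if ∃ y ∈ P.support, G.Adj x y then
    {z | z ∈ P.support.take (firstNbrIdx G P.support x + 1)}
  else vset P

noncomputable def A123 (G : SimpleGraph V) {a b : Fin 3 → V}
    (P : ∀ i : Fin 3, G.Walk (a i) (b i)) (x : V) : Set V :=
  ⋃ i, Aset G (P i) x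

/-- The index of `v` in the list `l`. -/
noncomputable def listIdx (l : List V) (v : V) : ℕ :=
  l.findIdx (fun z => decide (z = v))

/-- `K^m_n(v)`: the union of the maximal subpath of `P` from `v` towards the first end of
`P` of length at most `m` with no internal vertex in `Fs`, and the maximal subpath of `P`
from `v` towards the last end of `P` of length at most `n` with no internal vertex in `Fs`. -/
noncomputable def Kmn (G : SimpleGraph V) (Fs : Set V) {u w : V}
    (P : G.Walk u w) (v : V) (m n : ℕ) : Set V :=
  let t := listIdx P.support v
  {z | ∃ r, r ≤ t ∧ t - r ≤ m ∧
      (∀ q, r < q → q < t → P.support.getD q v ∉ Fs) ∧ z = P.support.getD r v} ∪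
  {z | ∃ r, t ≤ r ∧ r < P.support.length ∧ r - t ≤ n ∧
      (∀ q, t < q → q < r → P.support.getD q v ∉ Fs) ∧ z = P.support.getD r v}

/-- `y` is distant from `x` (both `K`-major), for a tidy near-prism. -/
def Distant (G : SimpleGraph V) (ℓ : ℕ) {a b : Fin 3 → V}
    (P : ∀ i : Fin 3, G.Walk (a i) (b i)) (x y : V) : Prop :=
  ¬ G.Adj x y ∧
  (∃ z ∈ A123 G P x, G.Adj y z) ∧
  (∀ i, (∃ z ∈ (P i).support, G.Adj x z) →
    ∀ z ∈ Kmn G (frameStar ℓ P) (P i) (alpha G (P i) x) (ℓ - 2) 1, ¬ G.Adj y z) ∧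
  (∀ i, (¬ ∃ z ∈ (P i).support, G.Adj x z) →
    ∃ j, j ≠ i ∧
      ∀ z ∈ Kmn G (frameStar ℓ P) (P j) (beta G (P j) x) 0 (ℓ - 3), ¬ G.Adj y z)

/-- The hole `c`, regarded as a graph on `V`. -/
def holeGraph (G : SimpleGraph V) {u : V} (c : G.Walk u u) : SimpleGraph V :=
  SimpleGraph.fromEdgeSet {e | e ∈ c.edges}

/-- The distance between two vertices in the hole `c`. -/
noncomputable def holeDist (G : SimpleGraph V) {u : V} (c : G.Walk u u) (x y : V) : ℕ :=
  (holeGraph G c).dist x y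

/-- `x` is `C`-major for the hole `c`: `x` is not on `c` and no path of `c` with at most
three vertices contains all neighbours of `x` on `c`. -/
def CMajor (G : SimpleGraph V) {u : V} (c : G.Walk u u) (x : V) : Prop :=
  x ∉ c.support ∧
  ¬ ∃ q ∈ c.support, ∀ z ∈ c.support, G.Adj x z → z = q ∨ s(q, z) ∈ c.edges

/-- A shortest long even hole. -/
def ShortestLEH (G : SimpleGraph V) (ℓ : ℕ) {u : V} (c : G.Walk u u) : Prop :=
  IsLongEvenHole ℓ c ∧
  ∀ (v : V) (c' : G.Walk v v), IsLongEvenHole ℓ c' → c.length ≤ c'.length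

/-- `L₁, L₂` are the two `x y`-paths of the hole `c`. -/
def ArcPair {G : SimpleGraph V} {u : V} (c : G.Walk u u) {x y : V}
    (L₁ L₂ : G.Walk x y) : Prop :=
  L₁.IsPath ∧ L₂.IsPath ∧
  (∀ e ∈ L₁.edges, e ∈ c.edges) ∧ (∀ e ∈ L₂.edges, e ∈ c.edges) ∧
  (∀ e ∈ c.edges, e ∈ L₁.edges ∨ e ∈ L₂.edges) ∧
  (∀ e ∈ L₁.edges, e ∉ L₂.edges)

/-- `X` is lighter than `Y`, with respect to the linear order on edges given by `idx`. -/
def Lighter [DecidableEq V] (idx : Sym2 V → ℕ) (X Y : Finset (Sym2 V)) : Prop :=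
  X.card < Y.card ∨
  (X.card = Y.card ∧ ∃ e ∈ Y, e ∉ X ∧
    ∀ f : Sym2 V, ((f ∈ X ∧ f ∉ Y) ∨ (f ∈ Y ∧ f ∉ X)) → idx e ≤ idx f)

/-- The lightest long even hole. -/
def LightestLEH [DecidableEq V] (G : SimpleGraph V) (ℓ : ℕ) (idx : Sym2 V → ℕ)
    {u : V} (c : G.Walk u u) : Prop :=
  IsLongEvenHole ℓ c ∧
  ∀ (v : V) (c' : G.Walk v v), IsLongEvenHole ℓ c' →
    c'.edges.toFinset ≠ c.edges.toFinset →
    Lighter idx c.edges.toFinset c'.edges.toFinset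

/-- A `(C,x)`-gap: a path of the hole `c` of length at least two whose ends are adjacent
to `x` and none of whose interior vertices is adjacent to `x`. -/
def IsGap (G : SimpleGraph V) {u : V} (c : G.Walk u u) (x : V) {p₁ p₂ : V}
    (P : G.Walk p₁ p₂) : Prop :=
  P.IsPath ∧ (∀ e ∈ P.edges, e ∈ c.edges) ∧ 2 ≤ P.length ∧
  G.Adj x p₁ ∧ G.Adj x p₂ ∧ ∀ z ∈ inter P, ¬ G.Adj x z

end LEH

open LEH

namespace LEH

theorem two_le_length_of_not_adj {V : Type*} {G : SimpleGraph V} {u v : V} {P : G.Walk u v}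
    (huv : u ≠ v) (hadj : ¬ G.Adj u v) :
    2 ≤ P.length := by
  by_contra! h
  obtain h | h : P.length = 0 ∨ P.length = 1 := by omega
  · exact huv (Walk.eq_of_length_eq_zero h)
  · exact hadj (Walk.adj_of_length_eq_one h)

/-- Two induced paths with common nonadjacent ends and anticomplete interiors form a hole. -/
theorem IsInducedPath.isHole_append_reverse {V : Type*} {G : SimpleGraph V} {u v : V}
    {P Q : G.Walk u v} (hP : IsInducedPath P) (hQ : IsInducedPath Q) (huv : u ≠ v)
    (hadj : ¬ G.Adj u v) (hPQ : Anticomplete G (inter P) (inter Q)) :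
    IsHole (P.append Q.reverse) := by
  have hP2 := two_le_length_of_not_adj (P := P) huv hadj
  have hQ2 := two_le_length_of_not_adj (P := Q) huv hadj
  have cross : ∀ x ∈ P.support, ∀ y ∈ Q.support, G.Adj x y →
      s(x, y) ∈ P.edges ∨ s(x, y) ∈ Q.edges := by
    intro x hx y hy hxy
    by_cases hxQ : x ∈ Q.support
    · exact .inr (hQ.2 x hxQ y hy hxy)
    by_cases hyP : y ∈ P.support
    · exact .inl (hP.2 x hx y hyP hxy)
    refine absurd hxy (hPQ ⟨hx, ?_, ?_⟩ ⟨hy, ?_, ?_⟩).2 <;> rintro rfl <;> simp_all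
  refine ⟨hP.1.isCycle_append hQ.1.reverse ?_ (.inl hP2), ?_, ?_⟩
  · intro x hxP hxQ
    have hu : u ∉ P.support.tail := by
      have := hP.1.support_nodup
      rw [← P.cons_tail_support] at this
      exact (List.nodup_cons.1 this).1
    have hv : v ∉ Q.reverse.support.tail := by
      have := hQ.1.reverse.support_nodup
      rw [← Q.reverse.cons_tail_support] at this
      exact (List.nodup_cons.1 this).1
    have hxu : x ≠ u := fun h => hu (h ▸ hxP)
    have hxv : x ≠ v := fun h => hv (h ▸ hxQ)
    have hxQ' : x ∈ Q.support := by simpa using List.mem_of_mem_tail hxQ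
    exact (hPQ ⟨List.mem_of_mem_tail hxP, hxu, hxv⟩ ⟨hxQ', hxu, hxv⟩).1 rfl
  · simp only [Walk.length_append, Walk.length_reverse]
    omega
  · simp only [Walk.mem_support_append_iff, Walk.support_reverse, List.mem_reverse,
      Walk.edges_append, Walk.edges_reverse, List.mem_append]
    rintro x (hx | hx) y (hy | hy) hxy
    · exact .inl (hP.2 x hx y hy hxy)
    · exact cross x hx y hy hxy
    · simpa only [Sym2.eq_swap] using cross y hy x hx hxy.symm
    · exact .inr (hQ.2 x hx y hy hxy)

end LEH

/-- a graph containing a long theta contains a long even hole. -/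
theorem longTheta_implies_longEvenHole {V : Type*} [Fintype V]
    (ℓ : ℕ) (hℓ : 6 ≤ ℓ) (hℓeven : Even ℓ)
    (G : SimpleGraph V) (h : HasLongTheta G ℓ) :
    HasLongEvenHole G ℓ := by
  obtain ⟨u, v, P₁, P₂, P₃, huv, hadj, h₁, h₂, h₃, h₁₂, h₁₃, h₂₃, hl₁₂, hl₁₃, hl₂₃⟩ := h
  have key : ∀ P Q : G.Walk u v, IsInducedPath P → IsInducedPath Q →
      Anticomplete G (inter P) (inter Q) → ℓ ≤ P.length + Q.length →
      Even (P.length + Q.length) → HasLongEvenHole G ℓ := fun P Q hP hQ hPQ hl he =>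
    ⟨u, P.append Q.reverse, hP.isHole_append_reverse hQ huv hadj hPQ, by simpa using hl,
      by simpa using he⟩
  obtain he | he | he : Even (P₁.length + P₂.length) ∨ Even (P₁.length + P₃.length) ∨
      Even (P₂.length + P₃.length) := by
    simp only [Nat.even_iff]
    omega
  · exact key P₁ P₂ h₁ h₂ h₁₂ hl₁₂ he
  · exact key P₁ P₃ h₁ h₃ h₁₃ hl₁₃ he
  · exact key P₂ P₃ h₂ h₃ h₂₃ hl₂₃ he
end

section
/- Let G be a prospect, and let K be a tidy shortest long near-prism in G with constituent paths P1, P2, P3. Then for all distinct i, j ∈ {1,2,3}, there is no induced path Q of G with one end in V(P_i) and the other end in V(P_j) such that: V(Q) is anticomplete to V(P_k), where k is the index in {1,2,3} \ {i,j}; no vertex of Q* is K-major; and 2|E(Q)| ≤ 1 + min(|E(P_i)|, |E(P_j)|). -/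
open SimpleGraph

open LEH

namespace LEH

/-- `S` is the vertex set of an induced path of length `n` from `a` to `b`. -/
def InducedPathOn {V : Type*} (G : SimpleGraph V) (a b : V) (S : Set V) (n : ℕ) : Prop :=
  ∃ W : G.Walk a b, IsInducedPath W ∧ vset W = S ∧ W.length = n

namespace InducedPathOn

variable {V : Type*} {G : SimpleGraph V} {a b x y : V} {S T : Set V} {m n : ℕ}

theorem single (v : V) : InducedPathOn G v v {v} 0 := by
  refine ⟨Walk.nil, ⟨Walk.IsPath.nil, ?_⟩, ?_, rfl⟩
  · intro x hx y hy h
    simp only [Walk.support_nil, List.mem_singleton] at hx hy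
    subst hx; subst hy
    exact absurd h (G.irrefl)
  · ext z; simp [vset]

theorem symm (h : InducedPathOn G a b S n) : InducedPathOn G b a S n := by
  obtain ⟨W, ⟨hp, hi⟩, hS, hn⟩ := h
  refine ⟨W.reverse, ⟨hp.reverse, ?_⟩, ?_, by simpa using hn⟩
  · simpa using hi
  · rw [← hS]; ext z; simp [vset]

/-- Two induced paths joined by a single edge between their ends form an induced path. -/
theorem join (h₁ : InducedPathOn G a x S m) (h₂ : InducedPathOn G y b T n) (hxy : G.Adj x y)
    (h : ∀ s ∈ S, ∀ t ∈ T, s ≠ t ∧ (G.Adj s t → s = x ∧ t = y)) :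
    InducedPathOn G a b (S ∪ T) (m + n + 1) := by
  obtain ⟨W₁, ⟨hp₁, hi₁⟩, rfl, rfl⟩ := h₁
  obtain ⟨W₂, ⟨hp₂, hi₂⟩, rfl, rfl⟩ := h₂
  have hs : (W₁.append (Walk.cons hxy W₂)).support = W₁.support ++ W₂.support := by
    simp [Walk.support_append]
  refine ⟨W₁.append (Walk.cons hxy W₂), ⟨?_, ?_⟩, ?_, ?_⟩
  · rw [Walk.isPath_def, hs, List.nodup_append]
    exact ⟨hp₁.support_nodup, hp₂.support_nodup, fun s hs t ht => (h s hs t ht).1⟩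
  · intro u hu v hv huv
    rw [hs, List.mem_append] at hu hv
    simp only [Walk.edges_append, Walk.edges_cons, List.mem_append, List.mem_cons]
    rcases hu with hu | hu <;> rcases hv with hv | hv
    · exact Or.inl (hi₁ u hu v hv huv)
    · obtain ⟨rfl, rfl⟩ := (h u hu v hv).2 huv
      exact Or.inr (Or.inl rfl)
    · obtain ⟨rfl, rfl⟩ := (h v hv u hu).2 huv.symm
      exact Or.inr (Or.inl Sym2.eq_swap)
    · exact Or.inr (Or.inr (hi₂ u hu v hv huv))
  · ext z; simp [vset, hs]
  · simp [Walk.length_append]; omega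

theorem ncard_le (h : InducedPathOn G a b S n) : S.ncard ≤ n + 1 := by
  classical
  obtain ⟨W, -, rfl, rfl⟩ := h
  have : vset W = ↑W.support.toFinset := by ext z; simp [vset]
  rw [this, Set.ncard_coe_finset, ← Walk.length_support]
  exact List.toFinset_card_le _

end InducedPathOn

/-- The sequence `p 0, …, p n` lists the vertices of an induced path in order. -/
def InducedSeq {V : Type*} (G : SimpleGraph V) (p : ℕ → V) (n : ℕ) : Prop :=
  ∀ s t, s ≤ n → t ≤ n →
    (p s = p t → s = t) ∧ (G.Adj (p s) (p t) ↔ s = t + 1 ∨ t = s + 1)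

/-- The sequences `p 0, …, p m` and `q 0, …, q n` are disjoint, and the only edges between them
join their first terms and their last terms. -/
def Matched {V : Type*} (G : SimpleGraph V) (p : ℕ → V) (m : ℕ) (q : ℕ → V) (n : ℕ) : Prop :=
  ∀ s t, s ≤ m → t ≤ n →
    p s ≠ q t ∧ (G.Adj (p s) (q t) ↔ (s = 0 ∧ t = 0) ∨ (s = m ∧ t = n))

section Sequences

variable {V : Type*} {G : SimpleGraph V} {p q : ℕ → V} {m n : ℕ}

theorem InducedSeq.reverse (h : InducedSeq G p n) : InducedSeq G (fun k => p (n - k)) n := by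
  intro s t hs ht
  have := h (n - s) (n - t) (by omega) (by omega)
  refine ⟨fun e => ?_, this.2.trans (by omega)⟩
  have := this.1 e
  omega

theorem InducedSeq.shift (h : InducedSeq G p n) {e M : ℕ} (hM : M + e ≤ n) :
    InducedSeq G (fun k => p (k + e)) M := by
  intro s t hs ht
  have := h (s + e) (t + e) (by omega) (by omega)
  refine ⟨fun e => ?_, this.2.trans (by omega)⟩
  have := this.1 e
  omega

theorem Matched.reverse (h : Matched G p m q n) :
    Matched G (fun k => p (m - k)) m (fun k => q (n - k)) n := by
  intro s t hs ht
  have := h (m - s) (n - t) (by omega) (by omega)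
  exact ⟨this.1, this.2.trans (by omega)⟩

theorem Matched.symm (h : Matched G p m q n) : Matched G q n p m := by
  intro s t hs ht
  have := h t s ht hs
  exact ⟨this.1.symm, by rw [G.adj_comm, this.2]; omega⟩

theorem InducedSeq.segment (h : InducedSeq G p n) {s t : ℕ} (hst : s ≤ t) (ht : t ≤ n) :
    InducedPathOn G (p s) (p t) (p '' Set.Icc s t) (t - s) := by
  induction t, hst using Nat.le_induction with
  | base => simpa using InducedPathOn.single (p s)
  | succ t hst ih =>
    have := (ih (by omega)).join (InducedPathOn.single (p (t + 1)))
      ((h t (t + 1) (by omega) ht).2.2 (Or.inr rfl)) (by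
        rintro _ ⟨k, ⟨hk, hk'⟩, rfl⟩ _ rfl
        have := h k (t + 1) (by omega) ht
        refine ⟨fun e => ?_, fun e => ⟨?_, rfl⟩⟩
        · have := this.1 e; omega
        · have := this.2.1 e
          congr 1; omega)
    convert this using 1
    · ext z
      simp only [Set.mem_image, Set.mem_Icc, Set.mem_union, Set.mem_singleton_iff]
      constructor
      · rintro ⟨k, ⟨h1, h2⟩, rfl⟩
        rcases Nat.lt_or_ge t k with h3 | h3
        · right; congr 1; omega
        · exact Or.inl ⟨k, ⟨h1, h3⟩, rfl⟩
      · rintro (⟨k, ⟨h1, h2⟩, rfl⟩ | rfl)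
        · exact ⟨k, ⟨h1, by omega⟩, rfl⟩
        · exact ⟨t + 1, ⟨by omega, le_rfl⟩, rfl⟩
    · omega

end Sequences

/-- Two disjoint induced paths whose first ends are adjacent, whose last ends are adjacent, and
which have no other edges between them form a hole. -/
theorem isLongHoleOn_of_inducedPathOn {V : Type*} {G : SimpleGraph V} {ℓ m n : ℕ}
    {a b c d : V} {S T : Set V} (h₁ : InducedPathOn G a b S m) (h₂ : InducedPathOn G c d T n)
    (hac : G.Adj a c) (hbd : G.Adj b d) (hmn : 2 ≤ m + n) (hℓ : ℓ ≤ m + n + 2)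
    (h : ∀ s ∈ S, ∀ t ∈ T, s ≠ t ∧ (G.Adj s t → (s = a ∧ t = c) ∨ (s = b ∧ t = d))) :
    IsLongHoleOn G ℓ (S ∪ T) := by
  obtain ⟨W₁, ⟨hp₁, hi₁⟩, rfl, rfl⟩ := h₁
  obtain ⟨W₂, ⟨hp₂, hi₂⟩, rfl, rfl⟩ := h₂
  set W := W₁.append (Walk.cons hbd W₂.reverse) with hW
  have hs : W.support = W₁.support ++ W₂.support.reverse := by
    simp [hW, Walk.support_append]
  have he : ∀ e, e ∈ W.edges ↔ e ∈ W₁.edges ∨ e = s(b, d) ∨ e ∈ W₂.edges := by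
    simp [hW, Walk.edges_append]
  have hc : c ∈ W₂.support := W₂.start_mem_support
  have ha : a ∈ W₁.support := W₁.start_mem_support
  have hl : W.length = W₁.length + W₂.length + 1 := by
    simp [hW, Walk.length_append]; omega
  refine ⟨c, Walk.cons hac.symm W, ⟨?_, ?_, ?_⟩, ?_, ?_⟩
  · rw [Walk.cons_isCycle_iff, Walk.isPath_def, hs, List.nodup_append]
    refine ⟨⟨hp₁.support_nodup, List.nodup_reverse.2 hp₂.support_nodup,
      fun s hs t ht => (h s hs t (List.mem_reverse.1 ht)).1⟩, ?_⟩
    rw [he]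
    rintro (e | e | e)
    · exact (h c (Walk.fst_mem_support_of_mem_edges _ e) c hc).1 rfl
    · rw [Sym2.eq_iff] at e
      rcases e with ⟨rfl, -⟩ | ⟨rfl, rfl⟩
      · exact (h _ W₁.end_mem_support _ hc).1 rfl
      · have h1 : W₁.length = 0 := by
          exact Walk.length_eq_zero_iff.2 (Walk.isPath_iff_nil.1 hp₁)
        have h2 : W₂.length = 0 := by
          exact Walk.length_eq_zero_iff.2 (Walk.isPath_iff_nil.1 hp₂)
        omega
    · exact (h a ha a (Walk.snd_mem_support_of_mem_edges _ e)).1 rfl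
  · rw [Walk.length_cons, hl]; omega
  · have hmem : ∀ u, u ∈ (Walk.cons hac.symm W).support → u ∈ W₁.support ∨ u ∈ W₂.support := by
      intro u hu
      rw [Walk.support_cons, hs] at hu
      simp only [List.mem_cons, List.mem_append, List.mem_reverse] at hu
      rcases hu with rfl | hu | hu
      · exact Or.inr hc
      · exact Or.inl hu
      · exact Or.inr hu
    intro u hu v hv huv
    rw [Walk.edges_cons, List.mem_cons, he]
    rcases hmem u hu with hu | hu <;> rcases hmem v hv with hv | hv
    · exact Or.inr (Or.inl (hi₁ u hu v hv huv))
    · rcases (h u hu v hv).2 huv with ⟨rfl, rfl⟩ | ⟨rfl, rfl⟩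
      · exact Or.inl Sym2.eq_swap
      · exact Or.inr (Or.inr (Or.inl rfl))
    · rcases (h v hv u hu).2 huv.symm with ⟨rfl, rfl⟩ | ⟨rfl, rfl⟩
      · exact Or.inl rfl
      · exact Or.inr (Or.inr (Or.inl Sym2.eq_swap))
    · exact Or.inr (Or.inr (Or.inr (hi₂ u hu v hv huv)))
  · rw [Walk.length_cons, hl]; omega
  · ext z
    simp only [Walk.support_cons, hs, vset, Set.mem_ofPred_eq, Set.mem_union, List.mem_cons,
      List.mem_append, List.mem_reverse]
    constructor
    · rintro (rfl | hz)
      · exact Or.inr hc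
      · exact hz
    · exact Or.inr

/-- A vertex of a hole has no neighbours in the hole other than any given two. -/
theorem IsHole.eq_or_eq_of_adj {V : Type*} {G : SimpleGraph V} {o u v w z : V} {c : G.Walk o o}
    (hc : IsHole c) (hu : u ∈ c.support) (hv : v ∈ c.support) (hw : w ∈ c.support)
    (hz : z ∈ c.support) (hvw : v ≠ w) (huv : G.Adj u v) (huw : G.Adj u w) (huz : G.Adj u z) :
    z = v ∨ z = w := by
  have h2 := hc.1.ncard_neighborSet_toSubgraph_eq_two hu
  have hm : ∀ t ∈ c.support, G.Adj u t → t ∈ c.toSubgraph.neighborSet u := by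
    intro t ht h
    rw [Subgraph.mem_neighborSet, ← Subgraph.mem_edgeSet, Walk.mem_edges_toSubgraph]
    exact hc.2.2 u hu t ht h
  obtain ⟨y, y', hy, he⟩ := Set.ncard_eq_two.1 h2
  have h1 := hm v hv huv
  have h3 := hm w hw huw
  have h4 := hm z hz huz
  rw [he] at h1 h3 h4
  simp only [Set.mem_insert_iff, Set.mem_singleton_iff] at h1 h3 h4
  rcases h1 with rfl | rfl <;> rcases h3 with rfl | rfl <;> rcases h4 with rfl | rfl <;> simp_all

section NearPrism

variable {V : Type*} {G : SimpleGraph V} {ℓ : ℕ}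

theorem getVert_eq_or_eq_of_adj {a₁ b₁ a₂ b₂ : V} {P₁ : G.Walk a₁ b₁} {P₂ : G.Walk a₂ b₂}
    (hp₁ : P₁.IsPath) (hp₂ : P₂.IsPath) (hd : ∀ x, x ∈ P₁.support → x ∉ P₂.support)
    (ha : G.Adj a₁ a₂) (hb : G.Adj b₁ b₂) (hn : 1 ≤ P₁.length + P₂.length)
    (hh : IsLongHoleOn G ℓ (vset P₁ ∪ vset P₂)) {s : ℕ} (hs : s ≤ P₁.length) {z : V}
    (hz : z ∈ vset P₁ ∪ vset P₂) (hsz : G.Adj (P₁.getVert s) z) :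
    (s = 0 ∧ z = a₂) ∨ (1 ≤ s ∧ z = P₁.getVert (s - 1)) ∨
      (s = P₁.length ∧ z = b₂) ∨ (s < P₁.length ∧ z = P₁.getVert (s + 1)) := by
  obtain ⟨o, c, hc, -, hS⟩ := hh
  have hm : ∀ t, t ∈ c.support ↔ t ∈ P₁.support ∨ t ∈ P₂.support := by
    intro t
    exact Set.ext_iff.1 hS t
  have key := fun {v w z : V} => hc.eq_or_eq_of_adj (v := v) (w := w) (z := z)
    ((hm _).2 (Or.inl (P₁.getVert_mem_support s)))
  have ha₂ := (hm a₂).2 (Or.inr P₂.start_mem_support)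
  have hb₂ := (hm b₂).2 (Or.inr P₂.end_mem_support)
  have hP : ∀ k, P₁.getVert k ∈ c.support := fun k => (hm _).2 (Or.inl (P₁.getVert_mem_support k))
  have hz' : z ∈ c.support := (hm z).2 hz
  have hne : ∀ k, ∀ v ∈ P₂.support, P₁.getVert k ≠ v := fun k v hv e =>
    hd _ (P₁.getVert_mem_support k) (e ▸ hv)
  rcases Nat.eq_zero_or_pos s with rfl | hs0 <;> rcases hs.eq_or_lt with h1 | h1
  · have hne' : a₂ ≠ b₂ := by
      rintro rfl
      have := Walk.length_eq_zero_iff.2 (Walk.isPath_iff_nil.1 hp₂)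
      omega
    have := key ha₂ hb₂ hz' hne' (by simpa using ha) (by rw [h1]; simpa using hb) hsz
    tauto
  · have := key ha₂ (hP 1) hz' (hne 1 _ P₂.start_mem_support).symm (by simpa using ha)
      (P₁.adj_getVert_succ h1) hsz
    simp only [zero_add]
    tauto
  · have h2 := P₁.adj_getVert_succ (i := s - 1) (by omega)
    rw [Nat.sub_add_cancel hs0] at h2
    have := key (hP (s - 1)) hb₂ hz' (hne _ _ P₂.end_mem_support) h2.symm
      (by rw [h1]; simpa using hb) hsz
    tauto
  · have h2 := P₁.adj_getVert_succ (i := s - 1) (by omega)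
    rw [Nat.sub_add_cancel hs0] at h2
    have := key (hP (s - 1)) (hP (s + 1)) hz' (fun e => by
      have := hp₁.getVert_injOn (by simp; omega) (by simp; omega) e
      omega) h2.symm (P₁.adj_getVert_succ h1) hsz
    tauto

theorem inducedSeq_getVert {a₁ b₁ a₂ b₂ : V} {P₁ : G.Walk a₁ b₁} {P₂ : G.Walk a₂ b₂}
    (hp₁ : P₁.IsPath) (hp₂ : P₂.IsPath) (hd : ∀ x, x ∈ P₁.support → x ∉ P₂.support)
    (ha : G.Adj a₁ a₂) (hb : G.Adj b₁ b₂) (hn : 1 ≤ P₁.length + P₂.length)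
    (hh : IsLongHoleOn G ℓ (vset P₁ ∪ vset P₂)) :
    InducedSeq G P₁.getVert P₁.length := by
  have inj : ∀ s t, s ≤ P₁.length → t ≤ P₁.length → P₁.getVert s = P₁.getVert t → s = t :=
    fun s t hs ht e => hp₁.getVert_injOn hs ht e
  intro s t hs ht
  refine ⟨inj s t hs ht, fun h => ?_, ?_⟩
  · have hmem := P₁.getVert_mem_support t
    rcases getVert_eq_or_eq_of_adj hp₁ hp₂ hd ha hb hn hh hs (Or.inl hmem) h with
      ⟨-, e⟩ | ⟨h1, e⟩ | ⟨-, e⟩ | ⟨h1, e⟩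
    · exact absurd P₂.start_mem_support (hd _ (e ▸ hmem))
    · have := inj _ _ ht (by omega) e; omega
    · exact absurd P₂.end_mem_support (hd _ (e ▸ hmem))
    · have := inj _ _ ht (by omega) e; omega
  · rintro (rfl | rfl)
    · exact (P₁.adj_getVert_succ (by omega)).symm
    · exact P₁.adj_getVert_succ (by omega)

theorem matched_getVert {a₁ b₁ a₂ b₂ : V} {P₁ : G.Walk a₁ b₁} {P₂ : G.Walk a₂ b₂}
    (hp₁ : P₁.IsPath) (hp₂ : P₂.IsPath) (hd : ∀ x, x ∈ P₁.support → x ∉ P₂.support)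
    (ha : G.Adj a₁ a₂) (hb : G.Adj b₁ b₂) (hn : 1 ≤ P₁.length + P₂.length)
    (hh : IsLongHoleOn G ℓ (vset P₁ ∪ vset P₂)) :
    Matched G P₁.getVert P₁.length P₂.getVert P₂.length := by
  intro s t hs ht
  have hmem := P₂.getVert_mem_support t
  refine ⟨fun e => hd _ (P₁.getVert_mem_support s) (e ▸ hmem), fun h => ?_, ?_⟩
  · rcases getVert_eq_or_eq_of_adj hp₁ hp₂ hd ha hb hn hh hs (Or.inr hmem) h with
      ⟨h1, e⟩ | ⟨-, e⟩ | ⟨h1, e⟩ | ⟨-, e⟩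
    · exact Or.inl ⟨h1, hp₂.getVert_injOn ht (by simp) (by simpa using e)⟩
    · exact absurd hmem (hd _ (e ▸ P₁.getVert_mem_support _))
    · exact Or.inr ⟨h1, hp₂.getVert_injOn ht (by simp) (by simpa using e)⟩
    · exact absurd hmem (hd _ (e ▸ P₁.getVert_mem_support _))
  · rintro (⟨rfl, rfl⟩ | ⟨rfl, rfl⟩) <;> simpa

/-- Three induced paths joining two disjoint triangles, with no other edges between them, form a
near-prism. -/
theorem exists_isLongNearPrism {a b : Fin 3 → V} {S : Fin 3 → Set V} {m : Fin 3 → ℕ}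
    (h : ∀ i, InducedPathOn G (a i) (b i) (S i) (m i))
    (ha : ∀ i j, i < j → G.Adj (a i) (a j)) (hb : ∀ i j, i < j → G.Adj (b i) (b j))
    (hab : ∀ i j, a i ≠ b j) (hℓ : 4 ≤ ℓ) (hm : ∀ i j, i < j → ℓ ≤ m i + m j + 2)
    (hS : ∀ i j, i < j → ∀ s ∈ S i, ∀ t ∈ S j,
      s ≠ t ∧ (G.Adj s t → (s = a i ∧ t = a j) ∨ (s = b i ∧ t = b j))) :
    ∃ P : ∀ i : Fin 3, G.Walk (a i) (b i), IsLongNearPrism ℓ a b P ∧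
      (prismSupport P).ncard ≤ m 0 + m 1 + m 2 + 3 := by
  choose P hP hPS hPm using id h
  refine ⟨P, ⟨?_, ?_, ?_, fun i => (hP i).1, ?_, ?_⟩, ?_⟩
  · intro i j hij
    rcases lt_or_gt_of_ne hij with hij | hij
    · exact ha i j hij
    · exact (ha j i hij).symm
  · intro i j hij
    rcases lt_or_gt_of_ne hij with hij | hij
    · exact hb i j hij
    · exact (hb j i hij).symm
  · rintro _ ⟨⟨i, rfl⟩, ⟨j, hj⟩⟩
    exact absurd hj.symm (hab i j)
  · intro i j hij x hx hx'
    replace hx : x ∈ S i := hPS i ▸ hx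
    replace hx' : x ∈ S j := hPS j ▸ hx'
    rcases lt_or_gt_of_ne hij with hij | hij
    · exact (hS i j hij x hx x hx').1 rfl
    · exact (hS j i hij x hx' x hx).1 rfl
  · intro i j hij
    rw [hPS, hPS]
    rcases lt_or_gt_of_ne hij with hij | hij
    · have := hm i j hij
      exact isLongHoleOn_of_inducedPathOn (h i) (h j) (ha i j hij) (hb i j hij) (by omega)
        (by omega) (hS i j hij)
    · have := hm j i hij
      rw [Set.union_comm]
      exact isLongHoleOn_of_inducedPathOn (h j) (h i) (ha j i hij) (hb j i hij) (by omega)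
        (by omega) (hS j i hij)
  · have e : prismSupport P = S 0 ∪ S 1 ∪ S 2 := by
      ext z
      simp [prismSupport, hPS, Fin.exists_fin_succ, or_assoc]
    rw [e]
    have h1 := Set.ncard_union_le (S 0 ∪ S 1) (S 2)
    have h2 := Set.ncard_union_le (S 0) (S 1)
    have h3 := (h 0).ncard_le
    have h4 := (h 1).ncard_le
    have h5 := (h 2).ncard_le
    omega

end NearPrism

/-- The sequences `p₁, p₂, p₃` are the constituent paths of a near-prism, and `q` is an induced
path whose interior is disjoint from the near-prism and has no neighbours in `p₃`, such that only
the second vertex of `q` has neighbours in `p₁` and only the penultimate one has neighbours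
in `p₂`; all these neighbours are at distance at least `d` from the ends of `p₁` and `p₂`. -/
structure IsJump {V : Type*} (G : SimpleGraph V) (d : ℕ) (p₁ : ℕ → V) (n₁ : ℕ) (p₂ : ℕ → V) (n₂ : ℕ)
    (p₃ : ℕ → V) (n₃ : ℕ) (q : ℕ → V) (L : ℕ) : Prop where
  ind₁ : InducedSeq G p₁ n₁
  ind₂ : InducedSeq G p₂ n₂
  ind₃ : InducedSeq G p₃ n₃
  matched₁₂ : Matched G p₁ n₁ p₂ n₂
  matched₁₃ : Matched G p₁ n₁ p₃ n₃
  matched₂₃ : Matched G p₂ n₂ p₃ n₃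
  ind : InducedSeq G q L
  two_le : 2 ≤ d
  three_le : 3 ≤ L
  fst : ∀ k j, 1 ≤ k → k < L → j ≤ n₁ →
    q k ≠ p₁ j ∧ (G.Adj (q k) (p₁ j) → k = 1 ∧ d ≤ j ∧ j + d ≤ n₁)
  snd : ∀ k j, 1 ≤ k → k < L → j ≤ n₂ →
    q k ≠ p₂ j ∧ (G.Adj (q k) (p₂ j) → k + 1 = L ∧ d ≤ j ∧ j + d ≤ n₂)
  trd : ∀ k j, 1 ≤ k → k < L → j ≤ n₃ → q k ≠ p₃ j ∧ ¬ G.Adj (q k) (p₃ j)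

namespace IsJump

variable {V : Type*} {G : SimpleGraph V} {d : ℕ} {p₁ p₂ p₃ q : ℕ → V} {n₁ n₂ n₃ L : ℕ}

theorem flip (J : IsJump G d p₁ n₁ p₂ n₂ p₃ n₃ q L) :
    IsJump G d (fun k => p₁ (n₁ - k)) n₁ (fun k => p₂ (n₂ - k)) n₂ (fun k => p₃ (n₃ - k)) n₃
      q L where
  ind₁ := J.ind₁.reverse
  ind₂ := J.ind₂.reverse
  ind₃ := J.ind₃.reverse
  matched₁₂ := J.matched₁₂.reverse
  matched₁₃ := J.matched₁₃.reverse
  matched₂₃ := J.matched₂₃.reverse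
  ind := J.ind
  two_le := J.two_le
  three_le := J.three_le
  fst k j hk hk' hj := by
    have := J.fst k (n₁ - j) hk hk' (by omega)
    exact ⟨this.1, fun h => by have := this.2 h; omega⟩
  snd k j hk hk' hj := by
    have := J.snd k (n₂ - j) hk hk' (by omega)
    exact ⟨this.1, fun h => by have := this.2 h; omega⟩
  trd k j hk hk' hj := J.trd k (n₃ - j) hk hk' (by omega)

theorem swap (J : IsJump G d p₁ n₁ p₂ n₂ p₃ n₃ q L) :
    IsJump G d p₂ n₂ p₁ n₁ p₃ n₃ (fun k => q (L - k)) L where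
  ind₁ := J.ind₂
  ind₂ := J.ind₁
  ind₃ := J.ind₃
  matched₁₂ := J.matched₁₂.symm
  matched₁₃ := J.matched₂₃
  matched₂₃ := J.matched₁₃
  ind := J.ind.reverse
  two_le := J.two_le
  three_le := J.three_le
  fst k j hk hk' hj := by
    have := J.snd (L - k) j (by omega) (by omega) hj
    exact ⟨this.1, fun h => by have := this.2 h; omega⟩
  snd k j hk hk' hj := by
    have := J.fst (L - k) j (by omega) (by omega) hj
    exact ⟨this.1, fun h => by have := this.2 h; omega⟩
  trd k j hk hk' hj := J.trd (L - k) j (by omega) (by omega) hj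

/-- If the neighbours of `q 1` in `p₁` are two consecutive vertices, then replacing the part of `p₂`
after the first neighbour of `q (L - 1)` by the interior of `q` yields a near-prism. -/
theorem exists_nearPrism (J : IsJump G d p₁ n₁ p₂ n₂ p₃ n₃ q L) {s f : ℕ} (hs1 : s + 1 ≤ n₁)
    (hs : ∀ j ≤ n₁, G.Adj (q 1) (p₁ j) ↔ j = s ∨ j = s + 1) (hfn : f ≤ n₂)
    (hf : G.Adj (q (L - 1)) (p₂ f)) (hf' : ∀ j < f, ¬ G.Adj (q (L - 1)) (p₂ j)) :
    ∃ (a b : Fin 3 → V) (P : ∀ i : Fin 3, G.Walk (a i) (b i)), IsLongNearPrism (2 * d + 2) a b P ∧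
      (prismSupport P).ncard ≤ n₁ + n₃ + f + L + 2 := by
  have hd := J.two_le
  have hL := J.three_le
  have e1 := (J.fst 1 s le_rfl (by omega) (by omega)).2 ((hs s (by omega)).2 (Or.inl rfl))
  have e2 := (J.fst 1 (s + 1) le_rfl (by omega) (by omega)).2 ((hs _ hs1).2 (Or.inr rfl))
  have e3 := (J.snd (L - 1) f (by omega) (by omega) hfn).2 hf
  have h0 := J.ind₁.segment (Nat.zero_le s) (by omega)
  have h1 := (J.ind₂.segment (Nat.zero_le f) hfn).join
    (J.ind.segment (s := 1) (t := L - 1) (by omega) (by omega)).symm hf.symm (by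
      rintro _ ⟨j, ⟨-, hj⟩, rfl⟩ _ ⟨k, ⟨hk, hk'⟩, rfl⟩
      have := J.snd k j hk (by omega) (by omega)
      refine ⟨this.1.symm, fun h => ?_⟩
      obtain ⟨h1, -⟩ := this.2 h.symm
      obtain rfl : k = L - 1 := by omega
      have : ¬ j < f := fun h' => hf' j h' h.symm
      obtain rfl : j = f := by omega
      exact ⟨rfl, rfl⟩)
  have h2 := (J.ind₃.segment (Nat.zero_le n₃) le_rfl).join
    (J.ind₁.segment (s := s + 1) (t := n₁) (by omega) le_rfl).symm
      (((J.matched₁₃ n₁ n₃ le_rfl le_rfl).2.2 (Or.inr ⟨rfl, rfl⟩)).symm) (by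
      rintro _ ⟨j, ⟨-, hj⟩, rfl⟩ _ ⟨k, ⟨hk, hk'⟩, rfl⟩
      have := J.matched₁₃ k j hk' hj
      refine ⟨this.1.symm, fun h => ?_⟩
      rcases this.2.1 h.symm with ⟨h1, -⟩ | ⟨rfl, rfl⟩
      · omega
      · exact ⟨rfl, rfl⟩)
  have hq1 : ∀ j ≤ n₁, q 1 ≠ p₁ j := fun j hj => (J.fst 1 j le_rfl (by omega) hj).1
  have hq2 : ∀ j ≤ n₂, q 1 ≠ p₂ j := fun j hj => (J.snd 1 j le_rfl (by omega) hj).1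
  have hq3 : ∀ j ≤ n₃, q 1 ≠ p₃ j := fun j hj => (J.trd 1 j le_rfl (by omega) hj).1
  obtain ⟨P, hP, hc⟩ := exists_isLongNearPrism (G := G) (ℓ := 2 * d + 2)
    (a := ![p₁ 0, p₂ 0, p₃ 0]) (b := ![p₁ s, q 1, p₁ (s + 1)])
    (S := ![_, _, _]) (m := ![_, _, _]) (by
      intro i
      fin_cases i
      exacts [h0, h1, h2]) (by
      intro i j hij
      fin_cases i <;> fin_cases j <;> first | exact absurd hij (by decide) | skip
      · exact (J.matched₁₂ 0 0 (by omega) (by omega)).2.2 (by simp)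
      · exact (J.matched₁₃ 0 0 (by omega) (by omega)).2.2 (by simp)
      · exact (J.matched₂₃ 0 0 (by omega) (by omega)).2.2 (by simp)) (by
      intro i j hij
      fin_cases i <;> fin_cases j <;> first | exact absurd hij (by decide) | skip
      · exact ((hs s (by omega)).2 (Or.inl rfl)).symm
      · exact (J.ind₁ s (s + 1) (by omega) hs1).2.2 (Or.inr rfl)
      · exact (hs (s + 1) hs1).2 (Or.inr rfl)) (by
      intro i j
      fin_cases i <;> fin_cases j
      · exact fun e => by have := (J.ind₁ 0 s (by omega) (by omega)).1 e; omega
      · exact (hq1 0 (by omega)).symm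
      · exact fun e => by have := (J.ind₁ 0 (s + 1) (by omega) (by omega)).1 e; omega
      · exact (J.matched₁₂ s 0 (by omega) (by omega)).1.symm
      · exact (hq2 0 (by omega)).symm
      · exact (J.matched₁₂ (s + 1) 0 (by omega) (by omega)).1.symm
      · exact (J.matched₁₃ s 0 (by omega) (by omega)).1.symm
      · exact (hq3 0 (by omega)).symm
      · exact (J.matched₁₃ (s + 1) 0 (by omega) (by omega)).1.symm) (by omega) (by
      intro i j hij
      fin_cases i <;> fin_cases j <;> first | exact absurd hij (by decide) | skip
      · change _ ≤ (s - 0) + (f - 0 + (L - 1 - 1) + 1) + 2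
        omega
      · change _ ≤ (s - 0) + (n₃ - 0 + (n₁ - (s + 1)) + 1) + 2
        omega
      · change _ ≤ (f - 0 + (L - 1 - 1) + 1) + (n₃ - 0 + (n₁ - (s + 1)) + 1) + 2
        omega) (by
      intro i j hij
      fin_cases i <;> fin_cases j <;> first | exact absurd hij (by decide) | skip
      · rintro _ ⟨k, ⟨-, hk⟩, rfl⟩ _ (⟨j, ⟨-, hj⟩, rfl⟩ | ⟨j, ⟨hj, hj'⟩, rfl⟩)
        · have := J.matched₁₂ k j (by omega) (by omega)
          refine ⟨this.1, fun h => ?_⟩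
          rcases this.2.1 h with ⟨rfl, rfl⟩ | ⟨rfl, rfl⟩
          · exact Or.inl ⟨rfl, rfl⟩
          · omega
        · have := J.fst j k hj (by omega) (by omega)
          refine ⟨this.1.symm, fun h => ?_⟩
          obtain ⟨rfl, -⟩ := this.2 h.symm
          rcases (hs k (by omega)).1 h.symm with rfl | rfl
          · exact Or.inr ⟨rfl, rfl⟩
          · omega
      · rintro _ ⟨k, ⟨-, hk⟩, rfl⟩ _ (⟨j, ⟨-, hj⟩, rfl⟩ | ⟨j, ⟨hj, hj'⟩, rfl⟩)
        · have := J.matched₁₃ k j (by omega) (by omega)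
          refine ⟨this.1, fun h => ?_⟩
          rcases this.2.1 h with ⟨rfl, rfl⟩ | ⟨rfl, rfl⟩
          · exact Or.inl ⟨rfl, rfl⟩
          · omega
        · have := J.ind₁ k j (by omega) (by omega)
          refine ⟨fun e => by have := this.1 e; omega, fun h => ?_⟩
          have := this.2.1 h
          obtain rfl : k = s := by omega
          obtain rfl : j = k + 1 := by omega
          exact Or.inr ⟨rfl, rfl⟩
      · rintro _ (⟨k, ⟨-, hk⟩, rfl⟩ | ⟨k, ⟨hk, hk'⟩, rfl⟩) _
          (⟨j, ⟨-, hj⟩, rfl⟩ | ⟨j, ⟨hj, hj'⟩, rfl⟩)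
        · have := J.matched₂₃ k j (by omega) (by omega)
          refine ⟨this.1, fun h => ?_⟩
          rcases this.2.1 h with ⟨rfl, rfl⟩ | ⟨rfl, rfl⟩
          · exact Or.inl ⟨rfl, rfl⟩
          · omega
        · have := J.matched₁₂ j k (by omega) (by omega)
          refine ⟨this.1.symm, fun h => ?_⟩
          have := this.2.1 h.symm
          omega
        · have := J.trd k j hk (by omega) (by omega)
          exact ⟨this.1, fun h => absurd h this.2⟩
        · have := J.fst k j hk (by omega) (by omega)
          refine ⟨this.1, fun h => ?_⟩
          obtain ⟨rfl, -⟩ := this.2 h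
          rcases (hs j (by omega)).1 h with rfl | rfl
          · omega
          · exact Or.inr ⟨rfl, rfl⟩)
  refine ⟨_, _, P, hP, hc.trans ?_⟩
  change (s - 0) + (f - 0 + (L - 1 - 1) + 1) + (n₃ - 0 + (n₁ - (s + 1)) + 1) + 3 ≤ _
  omega

end IsJump

/-- The path running from `v` along `p₂` to its first vertex and then along `p₁`. -/
theorem Matched.exists_inducedPathOn {V : Type*} {G : SimpleGraph V} {p₁ p₂ : ℕ → V} {n₁ n₂ : ℕ}
    (i₁ : InducedSeq G p₁ n₁) (i₂ : InducedSeq G p₂ n₂) (h : Matched G p₁ n₁ p₂ n₂) {v : V}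
    {s r : ℕ} (hs : s < n₁) (hr : r < n₂) (h₁ : ∀ j ≤ s, v ≠ p₁ j ∧ ¬ G.Adj v (p₁ j))
    (h₂ : ∀ j ≤ r, v ≠ p₂ j ∧ (G.Adj v (p₂ j) ↔ j = r)) :
    InducedPathOn G v (p₁ s) ({v} ∪ p₂ '' Set.Icc 0 r ∪ p₁ '' Set.Icc 0 s) (r + s + 2) := by
  have := ((InducedPathOn.single v).join (i₂.segment (Nat.zero_le r) hr.le).symm
    ((h₂ r le_rfl).2.2 rfl) (by
      rintro _ rfl _ ⟨j, ⟨-, hj⟩, rfl⟩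
      have := h₂ j hj
      exact ⟨this.1, fun e => ⟨rfl, by rw [this.2.1 e]⟩⟩)).join
    (i₁.segment (Nat.zero_le s) hs.le)
    ((h 0 0 (by omega) (by omega)).2.2 (Or.inl ⟨rfl, rfl⟩)).symm (by
      rintro _ (rfl | ⟨k, ⟨-, hk⟩, rfl⟩) _ ⟨j, ⟨-, hj⟩, rfl⟩
      · exact ⟨(h₁ j hj).1, fun e => absurd e (h₁ j hj).2⟩
      · have := h j k (by omega) (by omega)
        refine ⟨this.1.symm, fun e => ?_⟩
        rcases this.2.1 e.symm with ⟨rfl, rfl⟩ | ⟨rfl, rfl⟩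
        · exact ⟨rfl, rfl⟩
        · omega)
  convert this using 1
  omega

/-- One of the three paths of a theta with ends `c 0` and `c M`. -/
theorem Matched.exists_arc {V : Type*} {G : SimpleGraph V} {p₁ p₂ c : ℕ → V} {n₁ n₂ M s r : ℕ}
    (i₁ : InducedSeq G p₁ n₁) (i₂ : InducedSeq G p₂ n₂) (h : Matched G p₁ n₁ p₂ n₂)
    (hc : InducedSeq G c M) (hM : 2 ≤ M) (hs : 1 ≤ s) (hs' : s ≤ n₁) (hr : 1 ≤ r) (hr' : r ≤ n₂)
    (h₁ : ∀ k ≤ M, ∀ j ≤ n₁, j ≠ s →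
      c k ≠ p₁ j ∧ (G.Adj (c k) (p₁ j) ↔ k = 0 ∧ (j + 1 = s ∨ j = s + 1)))
    (h₂ : ∀ k ≤ M, ∀ j ≤ n₂, j ≠ r →
      c k ≠ p₂ j ∧ (G.Adj (c k) (p₂ j) ↔ k = M ∧ (j + 1 = r ∨ j = r + 1))) :
    ∃ W : G.Walk (c 0) (c M), IsInducedPath W ∧ W.length = s + r + 1 ∧
      ∀ z ∈ inter W, (∃ j < s, z = p₁ j) ∨ ∃ j < r, z = p₂ j := by
  obtain ⟨W, hW, hS, hl⟩ := (((Matched.exists_inducedPathOn i₁ i₂ h (v := c M) (s := s - 1)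
    (r := r - 1) (by omega) (by omega) (by
      intro j hj
      have := h₁ M le_rfl j (by omega) (by omega)
      exact ⟨this.1, fun e => by have := this.2.1 e; omega⟩) (by
      intro j hj
      have := h₂ M le_rfl j (by omega) (by omega)
      exact ⟨this.1, this.2.trans (by omega)⟩)).join (InducedPathOn.single (c 0))
    ((h₁ 0 (by omega) (s - 1) (by omega) (by omega)).2.2 (by omega)).symm (by
      rintro _ ((rfl | ⟨j, ⟨-, hj⟩, rfl⟩) | ⟨j, ⟨-, hj⟩, rfl⟩) _ rfl
      · have := hc M 0 (by omega) (by omega)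
        exact ⟨fun e => by have := this.1 e; omega, fun e => by have := this.2.1 e; omega⟩
      · have := h₂ 0 (by omega) j (by omega) (by omega)
        exact ⟨this.1.symm, fun e => by have := this.2.1 e.symm; omega⟩
      · have := h₁ 0 (by omega) j (by omega) (by omega)
        refine ⟨this.1.symm, fun e => ?_⟩
        have := this.2.1 e.symm
        exact ⟨by congr 1; omega, rfl⟩))).symm
  refine ⟨W, hW, by omega, ?_⟩
  rintro z ⟨hz, h0, h3⟩
  replace hz : z ∈ vset W := hz
  rw [hS] at hz
  rcases hz with ((rfl | ⟨j, ⟨-, hj⟩, rfl⟩) | ⟨j, ⟨-, hj⟩, rfl⟩) | rfl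
  · exact absurd rfl h3
  · exact Or.inr ⟨j, by omega, rfl⟩
  · exact Or.inl ⟨j, by omega, rfl⟩
  · exact absurd rfl h0

/-- A path with one end seeing just the two neighbours of `p₁ s` in `p₁`, and the other just those
of `p₂ r` in `p₂`, yields a theta. -/
theorem Matched.hasLongTheta {V : Type*} {G : SimpleGraph V} {d : ℕ} {p₁ p₂ c : ℕ → V}
    {n₁ n₂ M s r : ℕ}
    (i₁ : InducedSeq G p₁ n₁) (i₂ : InducedSeq G p₂ n₂) (h : Matched G p₁ n₁ p₂ n₂) (hd : 2 ≤ d)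
    (hc : InducedSeq G c M) (hM : 2 ≤ M) (hs : d ≤ s) (hs' : s + d ≤ n₁) (hr : d ≤ r)
    (hr' : r + d ≤ n₂)
    (h₁ : ∀ k ≤ M, ∀ j ≤ n₁, j ≠ s →
      c k ≠ p₁ j ∧ (G.Adj (c k) (p₁ j) ↔ k = 0 ∧ (j + 1 = s ∨ j = s + 1)))
    (h₂ : ∀ k ≤ M, ∀ j ≤ n₂, j ≠ r →
      c k ≠ p₂ j ∧ (G.Adj (c k) (p₂ j) ↔ k = M ∧ (j + 1 = r ∨ j = r + 1))) :
    HasLongTheta G (2 * d + 2) := by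
  obtain ⟨W₁, hW₁, hl₁, hi₁⟩ := Matched.exists_arc i₁ i₂ h hc hM (by omega) (by omega) (by omega)
    (by omega) h₁ h₂
  obtain ⟨W₂, hW₂, hl₂, hi₂⟩ := Matched.exists_arc i₁.reverse i₂.reverse h.reverse hc hM
    (s := n₁ - s) (r := n₂ - r) (by omega) (by omega) (by omega) (by omega)
    (by
      intro k hk j hj hne
      have := h₁ k hk (n₁ - j) (by omega) (by omega)
      exact ⟨this.1, this.2.trans (by omega)⟩)
    (by
      intro k hk j hj hne
      have := h₂ k hk (n₂ - j) (by omega) (by omega)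
      exact ⟨this.1, this.2.trans (by omega)⟩)
  obtain ⟨W₃, hW₃, hS₃, hl₃⟩ := hc.segment (Nat.zero_le M) le_rfl
  have hi₃ : ∀ z ∈ inter W₃, ∃ k, 0 < k ∧ k < M ∧ z = c k := by
    rintro z ⟨hz, h0, hM'⟩
    replace hz : z ∈ vset W₃ := hz
    rw [hS₃] at hz
    obtain ⟨k, ⟨-, hk⟩, rfl⟩ := hz
    refine ⟨k, Nat.pos_of_ne_zero ?_, lt_of_le_of_ne hk ?_, rfl⟩
    · rintro rfl; exact h0 rfl
    · rintro rfl; exact hM' rfl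
  have h0M := hc 0 M (by omega) le_rfl
  refine ⟨c 0, c M, W₁, W₂, W₃, fun e => ?_, fun e => ?_, hW₁, hW₂, hW₃, ?_, ?_, ?_, by omega,
    by omega, by omega⟩
  · have := h0M.1 e; omega
  · have := h0M.2.1 e; omega
  · intro z hz w hw
    rcases hi₁ z hz with ⟨j, hj, rfl⟩ | ⟨j, hj, rfl⟩ <;>
      rcases hi₂ w hw with ⟨k, hk, rfl⟩ | ⟨k, hk, rfl⟩
    · have := i₁ j (n₁ - k) (by omega) (by omega)
      exact ⟨fun e => by have := this.1 e; omega, fun e => by have := this.2.1 e; omega⟩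
    · have := h j (n₂ - k) (by omega) (by omega)
      exact ⟨this.1, fun e => by have := this.2.1 e; omega⟩
    · have := h (n₁ - k) j (by omega) (by omega)
      exact ⟨this.1.symm, fun e => by have := this.2.1 e.symm; omega⟩
    · have := i₂ j (n₂ - k) (by omega) (by omega)
      exact ⟨fun e => by have := this.1 e; omega, fun e => by have := this.2.1 e; omega⟩
  · intro z hz w hw
    obtain ⟨k, hk, hk', rfl⟩ := hi₃ w hw
    rcases hi₁ z hz with ⟨j, hj, rfl⟩ | ⟨j, hj, rfl⟩
    · have := h₁ k (by omega) j (by omega) (by omega)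
      exact ⟨this.1.symm, fun e => by have := this.2.1 e.symm; omega⟩
    · have := h₂ k (by omega) j (by omega) (by omega)
      exact ⟨this.1.symm, fun e => by have := this.2.1 e.symm; omega⟩
  · intro z hz w hw
    obtain ⟨k, hk, hk', rfl⟩ := hi₃ w hw
    rcases hi₂ z hz with ⟨j, hj, rfl⟩ | ⟨j, hj, rfl⟩
    · have := h₁ k (by omega) (n₁ - j) (by omega) (by omega)
      exact ⟨this.1.symm, fun e => by have := this.2.1 e.symm; omega⟩
    · have := h₂ k (by omega) (n₂ - j) (by omega) (by omega)
      exact ⟨this.1.symm, fun e => by have := this.2.1 e.symm; omega⟩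

/-- Adjacent vertices `u`, `v`, with `u` seeing both neighbours of `p₁ s` in `p₁`, and `v` both
neighbours of `p₂ r` in `p₂`, yield a ban-the-bomb. -/
theorem Matched.hasLongBanTheBomb {V : Type*} {G : SimpleGraph V} {d : ℕ} {p₁ p₂ : ℕ → V} {u v : V}
    {n₁ n₂ s r : ℕ}
    (i₁ : InducedSeq G p₁ n₁) (i₂ : InducedSeq G p₂ n₂) (h : Matched G p₁ n₁ p₂ n₂) (hd : 2 ≤ d)
    (huv : G.Adj u v) (hs : d < s) (hs' : s + d < n₁) (hr : d < r) (hr' : r + d < n₂)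
    (hu₁ : ∀ j ≤ n₁, u ≠ p₁ j) (hu₂ : ∀ j ≤ n₂, u ≠ p₂ j ∧ ¬ G.Adj u (p₂ j))
    (hv₁ : ∀ j ≤ n₁, v ≠ p₁ j ∧ ¬ G.Adj v (p₁ j)) (hv₂ : ∀ j ≤ n₂, v ≠ p₂ j)
    (h₁ : ∀ j ≤ n₁, j ≠ s → (G.Adj u (p₁ j) ↔ j + 1 = s ∨ j = s + 1))
    (h₂ : ∀ j ≤ n₂, j ≠ r → (G.Adj v (p₂ j) ↔ j + 1 = r ∨ j = r + 1)) :
    HasLongBanTheBomb G (2 * d + 2) := by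
  obtain ⟨W₁, hW₁, hS₁, hl₁⟩ := Matched.exists_inducedPathOn i₁ i₂ h (v := v) (s := s - 1)
    (r := r - 1) (by omega) (by omega) (fun j hj => hv₁ j (by omega))
    (fun j hj => ⟨hv₂ j (by omega), (h₂ j (by omega) (by omega)).trans (by omega)⟩)
  obtain ⟨W₂, hW₂, hS₂, hl₂⟩ := Matched.exists_inducedPathOn i₁.reverse i₂.reverse h.reverse
    (v := v) (s := n₁ - (s + 1)) (r := n₂ - (r + 1)) (by omega) (by omega)
    (fun j hj => hv₁ (n₁ - j) (by omega))
    (fun j hj => ⟨hv₂ (n₂ - j) (by omega), (h₂ (n₂ - j) (by omega) (by omega)).trans (by omega)⟩)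
  have e : n₁ - (n₁ - (s + 1)) = s + 1 := by omega
  have hmem₁ : ∀ z, z ∈ W₁.support → z = v ∨ (∃ j < r, z = p₂ j) ∨ ∃ j < s, z = p₁ j := by
    intro z hz
    replace hz : z ∈ vset W₁ := hz
    rw [hS₁] at hz
    rcases hz with (rfl | ⟨j, ⟨-, hj⟩, rfl⟩) | ⟨j, ⟨-, hj⟩, rfl⟩
    · exact Or.inl rfl
    · exact Or.inr (Or.inl ⟨j, by omega, rfl⟩)
    · exact Or.inr (Or.inr ⟨j, by omega, rfl⟩)
  have hmem₂ : ∀ z, z ∈ W₂.support → z = v ∨ (∃ j, r < j ∧ j ≤ n₂ ∧ z = p₂ j) ∨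
      ∃ j, s < j ∧ j ≤ n₁ ∧ z = p₁ j := by
    intro z hz
    replace hz : z ∈ vset W₂ := hz
    rw [hS₂] at hz
    rcases hz with (rfl | ⟨j, ⟨-, hj⟩, rfl⟩) | ⟨j, ⟨-, hj⟩, rfl⟩
    · exact Or.inl rfl
    · exact Or.inr (Or.inl ⟨n₂ - j, by omega, by omega, rfl⟩)
    · exact Or.inr (Or.inr ⟨n₁ - j, by omega, by omega, rfl⟩)
  refine ⟨u, p₁ (s - 1), p₁ s, _, v, W₁, W₂, (h₁ _ (by omega) (by omega)).2 (by omega),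
    (i₁ _ _ (by omega) (by omega)).2.2 (by omega), (i₁ _ _ (by omega) (by omega)).2.2 (by omega),
    ((h₁ _ (by omega) (by omega)).2 (by omega)).symm, fun e => ?_, hu₁ _ (by omega), huv.symm,
    (hv₁ _ (by omega)).2, (hv₁ _ (by omega)).2, (hv₁ _ (by omega)).2,
    (hv₁ _ (by omega)).1, (hv₁ _ (by omega)).1, (hv₁ _ (by omega)).1, hW₁, hW₂, by omega, by omega,
    ?_, ?_, ?_, by omega, by omega, by omega⟩
  · have := (i₁ _ _ (by omega) (by omega)).2.1 e; omega
  · rintro z ⟨hz, h0, h3⟩ w hw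
    rcases hmem₁ z hz with rfl | ⟨j, hj, rfl⟩ | ⟨j, hj, rfl⟩
    · exact absurd rfl h0
    · rcases hw with rfl | rfl
      · have := hu₂ j (by omega)
        exact ⟨this.1.symm, fun e => this.2 e.symm⟩
      · have := h s j (by omega) (by omega)
        exact ⟨this.1.symm, fun e => by have := this.2.1 e.symm; omega⟩
    · have hne : j + 1 ≠ s := fun e => h3 (by congr 1; omega)
      rcases hw with rfl | rfl
      · have := h₁ j (by omega) (by omega)
        exact ⟨(hu₁ j (by omega)).symm, fun e => by have := this.1 e.symm; omega⟩
      · have := i₁ j s (by omega) (by omega)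
        exact ⟨fun e => by have := this.1 e; omega, fun e => by have := this.2.1 e; omega⟩
  · rintro z ⟨hz, h0, h3⟩ w hw
    rcases hmem₂ z hz with rfl | ⟨j, hj, hj', rfl⟩ | ⟨j, hj, hj', rfl⟩
    · exact absurd rfl h0
    · rcases hw with rfl | rfl
      · have := hu₂ j (by omega)
        exact ⟨this.1.symm, fun e => this.2 e.symm⟩
      · have := h s j (by omega) (by omega)
        exact ⟨this.1.symm, fun e => by have := this.2.1 e.symm; omega⟩
    · have hne : j ≠ s + 1 := fun e' => h3 (by congr 1; omega)
      rcases hw with rfl | rfl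
      · have := h₁ j (by omega) (by omega)
        exact ⟨(hu₁ j (by omega)).symm, fun e => by have := this.1 e.symm; omega⟩
      · have := i₁ j s (by omega) (by omega)
        exact ⟨fun e => by have := this.1 e; omega, fun e => by have := this.2.1 e; omega⟩
  · rintro z ⟨hz, h0⟩ w ⟨hw, h3⟩
    rcases hmem₁ z hz with rfl | ⟨j, hj, rfl⟩ | ⟨j, hj, rfl⟩
    · exact absurd rfl h0
    · rcases hmem₂ w hw with rfl | ⟨k, hk, hk', rfl⟩ | ⟨k, hk, hk', rfl⟩
      · exact absurd rfl h3
      · have := i₂ j k (by omega) (by omega)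
        exact ⟨fun e => by have := this.1 e; omega, fun e => by have := this.2.1 e; omega⟩
      · have := h k j (by omega) (by omega)
        exact ⟨this.1.symm, fun e => by have := this.2.1 e.symm; omega⟩
    · rcases hmem₂ w hw with rfl | ⟨k, hk, hk', rfl⟩ | ⟨k, hk, hk', rfl⟩
      · exact absurd rfl h3
      · have := h j k (by omega) (by omega)
        exact ⟨this.1, fun e => by have := this.2.1 e; omega⟩
      · have := i₁ j k (by omega) (by omega)
        exact ⟨fun e => by have := this.1 e; omega, fun e => by have := this.2.1 e; omega⟩

/-- The first and last neighbours of `v` in the sequence `p 0, …, p n` are `p f` and `p g`. -/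
def NbrSpan {V : Type*} (G : SimpleGraph V) (v : V) (p : ℕ → V) (n f g : ℕ) : Prop :=
  f ≤ g ∧ g ≤ n ∧ G.Adj v (p f) ∧ G.Adj v (p g) ∧ ∀ j ≤ n, G.Adj v (p j) → f ≤ j ∧ j ≤ g

namespace IsJump

variable {V : Type*} {G : SimpleGraph V} {d : ℕ} {p₁ p₂ p₃ q : ℕ → V} {n₁ n₂ n₃ L : ℕ}
  {f₁ g₁ f₂ g₂ : ℕ}

theorem lt_two_mul_of_consecutive (J : IsJump G d p₁ n₁ p₂ n₂ p₃ n₃ q L)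
    (h₁ : NbrSpan G (q 1) p₁ n₁ f₁ g₁) (h₂ : NbrSpan G (q (L - 1)) p₂ n₂ f₂ g₂)
    (hfg : g₁ = f₁ + 1)
    (hmin : ∀ (a b : Fin 3 → V) (P : ∀ i : Fin 3, G.Walk (a i) (b i)),
      IsLongNearPrism (2 * d + 2) a b P → n₁ + n₂ + n₃ + 3 ≤ (prismSupport P).ncard) :
    n₂ + 1 < 2 * L := by
  obtain ⟨-, h1, h2, h3, h4⟩ := h₁
  obtain ⟨k0, k1, k2, k3, k4⟩ := h₂
  subst hfg
  obtain ⟨a, b, P, hP, hc⟩ := J.exists_nearPrism (s := f₁) (f := f₂) h1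
    (fun j hj => ⟨fun e => by have := h4 j hj e; omega, by rintro (rfl | rfl) <;> assumption⟩)
    (by omega) k2 (fun j hj e => by have := k4 j (by omega) e; omega)
  have hc1 := hmin a b P hP
  obtain ⟨a, b, P, hP, hc⟩ := J.flip.exists_nearPrism (s := n₁ - (f₁ + 1)) (f := n₂ - g₂) (by omega)
    (fun j hj => ⟨fun e => by have := h4 _ (by omega) e; omega, by
      rintro (rfl | rfl)
      · rwa [show n₁ - (n₁ - (f₁ + 1)) = f₁ + 1 by omega]
      · rwa [show n₁ - (n₁ - (f₁ + 1) + 1) = f₁ by omega]⟩)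
    (by omega) (by rwa [show n₂ - (n₂ - g₂) = g₂ by omega])
    (fun j hj e => by have := k4 _ (by omega) e; omega)
  have hc2 := hmin a b P hP
  omega

theorem ne_and_adj_iff (J : IsJump G d p₁ n₁ p₂ n₂ p₃ n₃ q L)
    (h₁ : NbrSpan G (q 1) p₁ n₁ f₁ g₁) {x y e e' s : ℕ} (hx : x ≤ n₁) (hqx : q 0 = p₁ x)
    (hy : y ≤ n₂) (hqy : q L = p₂ y)
    (he : (e = 0 ∧ g₁ = f₁ ∧ s = f₁) ∨ (e = 1 ∧ g₁ = f₁ + 2 ∧ s = f₁ + 1))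
    {k j : ℕ} (hk : k + e + e' ≤ L) (hj : j ≤ n₁) (hjs : j ≠ s) :
    q (k + e) ≠ p₁ j ∧ (G.Adj (q (k + e)) (p₁ j) ↔ k = 0 ∧ (j + 1 = s ∨ j = s + 1)) := by
  obtain ⟨h0, h1, h2, h3, h4⟩ := h₁
  have hd := J.two_le
  have hL := J.three_le
  have hqx' : G.Adj (q 1) (p₁ x) := by
    rw [← hqx]; exact (J.ind 1 0 (by omega) (by omega)).2.2 (by omega)
  have hy' : d ≤ y ∧ y + d ≤ n₂ := by
    refine ((J.snd (L - 1) y (by omega) (by omega) hy).2 ?_).2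
    rw [← hqy]; exact (J.ind _ _ (by omega) (by omega)).2.2 (by omega)
  by_cases hk0 : k + e = 0
  · obtain rfl : k = 0 := by omega
    obtain rfl : e = 0 := by omega
    have := h4 x hx hqx'
    obtain rfl : x = s := by omega
    rw [zero_add, hqx]
    have := J.ind₁ x j (by omega) hj
    exact ⟨fun e => hjs (this.1 e).symm, this.2.trans (by omega)⟩
  by_cases hkL : k + e = L
  · rw [hkL, hqy]
    have := J.matched₁₂ j y hj hy
    refine ⟨this.1.symm, ?_⟩
    rw [G.adj_comm, this.2]
    omega
  · have := J.fst (k + e) j (by omega) (by omega) hj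
    refine ⟨this.1, fun h => ?_, ?_⟩
    · obtain ⟨h5, -⟩ := this.2 h
      rw [h5] at h
      have := h4 j hj h
      omega
    · rintro ⟨rfl, h⟩
      rcases he with ⟨rfl, -⟩ | ⟨rfl, rfl, rfl⟩
      · omega
      · rcases h with h | h
        · obtain rfl : j = f₁ := by omega
          exact h2
        · obtain rfl : j = f₁ + 2 := by omega
          exact h3

/-- There are no short jumps over a smallest near-prism in a graph without long thetas and long
bans-the-bomb. -/
theorem lt_two_mul_length (J : IsJump G d p₁ n₁ p₂ n₂ p₃ n₃ q L)
    (h₁ : NbrSpan G (q 1) p₁ n₁ f₁ g₁) (h₂ : NbrSpan G (q (L - 1)) p₂ n₂ f₂ g₂)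
    (h₁' : g₁ ≤ f₁ + 2) (h₂' : g₂ ≤ f₂ + 2)
    {x y : ℕ} (hx : x ≤ n₁) (hqx : q 0 = p₁ x) (hy : y ≤ n₂) (hqy : q L = p₂ y)
    (hmin : ∀ (a b : Fin 3 → V) (P : ∀ i : Fin 3, G.Walk (a i) (b i)),
      IsLongNearPrism (2 * d + 2) a b P → n₁ + n₂ + n₃ + 3 ≤ (prismSupport P).ncard)
    (htheta : ¬ HasLongTheta G (2 * d + 2)) (hbomb : ¬ HasLongBanTheBomb G (2 * d + 2)) :
    min n₁ n₂ + 1 < 2 * L := by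
  have hd := J.two_le
  have hL := J.three_le
  have hL1 : L - (L - 1) = 1 := by omega
  have s₁ : NbrSpan G (q (L - (L - 1))) p₁ n₁ f₁ g₁ := by rwa [hL1]
  by_cases t₁ : g₁ = f₁ + 1
  · have := J.lt_two_mul_of_consecutive h₁ h₂ t₁ hmin
    omega
  by_cases t₂ : g₂ = f₂ + 1
  · have := J.swap.lt_two_mul_of_consecutive h₂ s₁ t₂ (fun a b P hP => by
      have := hmin a b P hP
      omega)
    omega
  exfalso
  have b₁ := (J.fst 1 f₁ le_rfl (by omega) (h₁.1.trans h₁.2.1)).2 h₁.2.2.1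
  have b₁' := (J.fst 1 g₁ le_rfl (by omega) h₁.2.1).2 h₁.2.2.2.1
  have b₂ := (J.snd (L - 1) f₂ (by omega) (by omega) (h₂.1.trans h₂.2.1)).2 h₂.2.2.1
  have b₂' := (J.snd (L - 1) g₂ (by omega) (by omega) h₂.2.1).2 h₂.2.2.2.1
  obtain ⟨e, s, he⟩ : ∃ e s, (e = 0 ∧ g₁ = f₁ ∧ s = f₁) ∨ (e = 1 ∧ g₁ = f₁ + 2 ∧ s = f₁ + 1) := by
    have := h₁.1
    rcases (by omega : g₁ = f₁ ∨ g₁ = f₁ + 2) with h | h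
    · exact ⟨0, f₁, Or.inl ⟨rfl, h, rfl⟩⟩
    · exact ⟨1, f₁ + 1, Or.inr ⟨rfl, h, rfl⟩⟩
  obtain ⟨e', r, he'⟩ : ∃ e' r,
      (e' = 0 ∧ g₂ = f₂ ∧ r = f₂) ∨ (e' = 1 ∧ g₂ = f₂ + 2 ∧ r = f₂ + 1) := by
    have := h₂.1
    rcases (by omega : g₂ = f₂ ∨ g₂ = f₂ + 2) with h | h
    · exact ⟨0, f₂, Or.inl ⟨rfl, h, rfl⟩⟩
    · exact ⟨1, f₂ + 1, Or.inr ⟨rfl, h, rfl⟩⟩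
  have c₁ : ∀ k, k + e + e' ≤ L → ∀ j ≤ n₁, j ≠ s → q (k + e) ≠ p₁ j ∧
      (G.Adj (q (k + e)) (p₁ j) ↔ k = 0 ∧ (j + 1 = s ∨ j = s + 1)) :=
    fun k hk j hj hjs => J.ne_and_adj_iff h₁ hx hqx hy hqy he hk hj hjs
  have c₂ : ∀ k, k + e + e' ≤ L → ∀ j ≤ n₂, j ≠ r → q (k + e) ≠ p₂ j ∧
      (G.Adj (q (k + e)) (p₂ j) ↔ k + e + e' = L ∧ (j + 1 = r ∨ j = r + 1)) := by
    intro k hk j hj hjr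
    have := J.swap.ne_and_adj_iff (k := L - (k + e + e')) (e' := e) h₂ hy (by simpa using hqy) hx
      (by simpa using hqx) he' (by omega) hj hjr
    simp only [show L - (L - (k + e + e') + e') = k + e by omega] at this
    exact ⟨this.1, this.2.trans (by omega)⟩
  by_cases hM : 2 ≤ L - e - e'
  · exact htheta (J.matched₁₂.hasLongTheta J.ind₁ J.ind₂ hd
      (c := fun k => q (k + e)) (M := L - e - e') (s := s) (r := r) (J.ind.shift (by omega)) hM
      (by omega) (by omega) (by omega) (by omega) (fun k hk => c₁ k (by omega))
      (fun k hk j hj hjr => by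
        have := c₂ k (by omega) j hj hjr
        exact ⟨this.1, this.2.trans (by omega)⟩))
  · obtain rfl : L = 3 := by omega
    obtain rfl : e = 1 := by omega
    obtain rfl : e' = 1 := by omega
    refine hbomb (J.matched₁₂.hasLongBanTheBomb J.ind₁ J.ind₂ hd (u := q 1) (v := q 2) (s := s)
      (r := r) ((J.ind 1 2 (by omega) (by omega)).2.2 (by omega))
      (by omega) (by omega) (by omega) (by omega)
      (fun j hj => (J.fst 1 j (by omega) (by omega) hj).1)
      (fun j hj => ?_) (fun j hj => ?_) (fun j hj => (J.snd 2 j (by omega) (by omega) hj).1)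
      (fun j hj hjs => ?_) (fun j hj hjr => ?_))
    · have := J.snd 1 j (by omega) (by omega) hj
      exact ⟨this.1, fun e => by have := this.2 e; omega⟩
    · have := J.fst 2 j (by omega) (by omega) hj
      exact ⟨this.1, fun e => by have := this.2 e; omega⟩
    · exact (c₁ 0 (by omega) j hj hjs).2.trans (by omega)
    · exact (c₂ 1 (by omega) j hj hjr).2.trans (by omega)

end IsJump

/-- A shortest walk inside `X` from `A` to `B` is an induced path, and only its second vertex has
further neighbours in `A ∩ X`, and only its penultimate vertex in `B ∩ X`. -/
theorem exists_shortest_inducedSeq {V : Type*} {G : SimpleGraph V} {A B X : Set V} {x y : V}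
    (hx : x ∈ A) (hy : y ∈ B) (Q : G.Walk x y) (hX : ∀ z ∈ Q.support, z ∈ X) :
    ∃ (L : ℕ) (q : ℕ → V), L ≤ Q.length ∧ q 0 ∈ A ∧ q L ∈ B ∧ (∀ k ≤ L, q k ∈ X) ∧
      InducedSeq G q L ∧ (∀ k, 1 ≤ k → k ≤ L → q k ∉ A) ∧ (∀ k < L, q k ∉ B) ∧
      (∀ k, 2 ≤ k → k ≤ L → ∀ z ∈ A, z ∈ X → ¬ G.Adj (q k) z) ∧
      (∀ k, k + 2 ≤ L → ∀ z ∈ B, z ∈ X → ¬ G.Adj (q k) z) := by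
  classical
  let C : ℕ → Prop := fun L => ∃ q : ℕ → V, q 0 ∈ A ∧ q L ∈ B ∧ (∀ k ≤ L, q k ∈ X) ∧
    ∀ k < L, G.Adj (q k) (q (k + 1))
  have hC : C Q.length := ⟨Q.getVert, by simpa using hx, by simpa using hy,
    fun k _ => hX _ (Q.getVert_mem_support k), fun k hk => Q.adj_getVert_succ hk⟩
  have hex : ∃ L, C L := ⟨_, hC⟩
  obtain ⟨q, h0, hL, hqX, hadj⟩ := Nat.find_spec hex
  have hmin : ∀ M, C M → Nat.find hex ≤ M := fun M hM => Nat.find_min' hex hM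
  have hle : Nat.find hex ≤ Q.length := hmin _ hC
  generalize Nat.find hex = L at *
  have hB : ∀ k < L, q k ∉ B := fun k hk hkB => by
    have := hmin k ⟨q, h0, hkB, fun j hj => hqX j (by omega), fun j hj => hadj j (by omega)⟩
    omega
  have hshort : ∀ s t, s + 1 < t → t ≤ L → ¬ G.Adj (q s) (q t) := by
    intro s t hst ht e
    have := hmin (L - (t - s - 1)) ⟨fun j => if j ≤ s then q j else q (j + (t - s - 1)),
      by simpa using h0, ?_, ?_, ?_⟩
    · omega
    · dsimp only
      rw [if_neg (by omega), show L - (t - s - 1) + (t - s - 1) = L by omega]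
      exact hL
    · intro k hk
      dsimp only
      split_ifs
      · exact hqX k (by omega)
      · exact hqX _ (by omega)
    · intro k hk
      dsimp only
      rcases lt_trichotomy k s with h | rfl | h
      · rw [if_pos (by omega), if_pos (by omega)]
        exact hadj k (by omega)
      · rw [if_pos (by omega), if_neg (by omega), show k + 1 + (t - k - 1) = t by omega]
        exact e
      · rw [if_neg (by omega), if_neg (by omega),
          show k + 1 + (t - s - 1) = k + (t - s - 1) + 1 by omega]
        exact hadj _ (by omega)
  have hne : ∀ s t, s < t → t ≤ L → q s ≠ q t := by
    intro s t hst ht e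
    rcases ht.lt_or_eq with ht | rfl
    · exact hshort s (t + 1) (by omega) (by omega) (e ▸ hadj t ht)
    · exact hB s hst (e ▸ hL)
  refine ⟨L, q, hle, h0, hL, hqX, ?_, ?_, hB, ?_, ?_⟩
  · intro s t hs ht
    refine ⟨fun e => ?_, fun e => ?_, ?_⟩
    · rcases lt_trichotomy s t with h | h | h
      · exact absurd e (hne s t h ht)
      · exact h
      · exact absurd e.symm (hne t s h hs)
    · have hst : s ≠ t := by rintro rfl; exact G.irrefl e
      by_contra hcon
      rcases lt_or_gt_of_ne hst with h | h
      · exact hshort s t (by omega) ht e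
      · exact hshort t s (by omega) hs e.symm
    · rintro (rfl | rfl)
      · exact (hadj t (by omega)).symm
      · exact hadj s (by omega)
  · intro k hk hkL hkA
    have := hmin (L - k) ⟨fun j => q (j + k), by simpa using hkA,
      by simpa [Nat.sub_add_cancel hkL] using hL, fun j hj => hqX _ (by omega), fun j hj => by
        have := hadj (j + k) (by omega)
        rwa [show j + k + 1 = j + 1 + k by omega] at this⟩
    omega
  · intro k hk hkL z hzA hzX e
    have := hmin (L - k + 1) ⟨fun j => if j = 0 then z else q (j - 1 + k), by simpa using hzA, ?_,
      ?_, ?_⟩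
    · omega
    · dsimp only
      rw [if_neg (by omega), show L - k + 1 - 1 + k = L by omega]
      exact hL
    · intro j hj
      dsimp only
      split_ifs
      · exact hzX
      · exact hqX _ (by omega)
    · intro j hj
      dsimp only
      rcases Nat.eq_zero_or_pos j with rfl | h
      · simpa using e.symm
      · rw [if_neg (by omega), if_neg (by omega), show j + 1 - 1 + k = j - 1 + k + 1 by omega]
        exact hadj _ (by omega)
  · intro k hkL z hzB hzX e
    have := hmin (k + 1) ⟨fun j => if j ≤ k then q j else z, by simpa using h0, ?_, ?_, ?_⟩
    · omega
    · dsimp only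
      rw [if_neg (by omega)]
      exact hzB
    · intro j hj
      dsimp only
      split_ifs
      · exact hqX _ (by omega)
      · exact hzX
    · intro j hj
      dsimp only
      rcases (by omega : j < k ∨ j = k) with h | rfl
      · rw [if_pos (by omega), if_pos (by omega)]
        exact hadj _ (by omega)
      · rw [if_pos (by omega), if_neg (by omega)]
        exact e

theorem exists_nbrSpan {V : Type*} {G : SimpleGraph V} {v : V} {p : ℕ → V} {n k c : ℕ} (hk : k ≤ n)
    (hv : G.Adj v (p k))
    (h : ∀ s t, s ≤ n → t ≤ n → G.Adj v (p s) → G.Adj v (p t) → t ≤ s + c) :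
    ∃ f g, NbrSpan G v p n f g ∧ g ≤ f + c := by
  classical
  let S := (Finset.range (n + 1)).filter fun j => G.Adj v (p j)
  have hS : ∀ j, j ∈ S ↔ j ≤ n ∧ G.Adj v (p j) := by
    intro j
    simp [S]
  have hne : S.Nonempty := ⟨k, (hS k).2 ⟨hk, hv⟩⟩
  have hf := (hS _).1 (S.min'_mem hne)
  have hg := (hS _).1 (S.max'_mem hne)
  exact ⟨S.min' hne, S.max' hne, ⟨S.min'_le _ (S.max'_mem hne), hg.1, hf.2, hg.2, fun j hj hj' =>
    ⟨S.min'_le _ ((hS j).2 ⟨hj, hj'⟩), S.le_max' _ ((hS j).2 ⟨hj, hj'⟩)⟩⟩,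
    h _ _ hf.1 hg.1 hf.2 hg.2⟩

section Tidy

variable {V : Type*} {G : SimpleGraph V} {ℓ : ℕ} {a b : Fin 3 → V}
  {P : ∀ i : Fin 3, G.Walk (a i) (b i)}

theorem mem_prismSupport {z : V} : z ∈ prismSupport P ↔ ∃ i, ∃ k ≤ (P i).length,
    z = (P i).getVert k := by
  simp only [prismSupport, Set.mem_iUnion, vset, Set.mem_ofPred_eq,
    Walk.mem_support_iff_exists_getVert]
  constructor
  · rintro ⟨i, k, rfl, hk⟩
    exact ⟨i, k, hk, rfl⟩
  · rintro ⟨i, k, hk, rfl⟩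
    exact ⟨i, k, rfl, hk⟩

theorem getVert_mem_take_support {u v : V} (W : G.Walk u v) {k m : ℕ} (hk : k ≤ W.length)
    (hm : k < m) : W.getVert k ∈ W.support.take m := by
  have hk' : k < W.support.length := by rw [Walk.length_support]; omega
  rw [List.mem_take_iff_getElem]
  exact ⟨k, by omega, by rw [Walk.support_getElem_eq_getVert]⟩

theorem Tidy.le_of_adj (h : Tidy G ℓ P) {z : V} (hz : z ∉ prismSupport P) {i : Fin 3} {k : ℕ}
    (hk : k ≤ (P i).length) (hzk : G.Adj z ((P i).getVert k)) :
    ℓ ≤ (P i).length ∧ ℓ / 2 - 1 ≤ k ∧ k + (ℓ / 2 - 1) ≤ (P i).length := by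
  have hF : (P i).getVert k ∉ frameStar ℓ P := fun hF => (h.2 hF hz).2 hzk.symm
  rw [frameStar, Set.mem_iUnion] at hF
  have hF := fun h => hF ⟨i, h⟩
  split_ifs at hF with hl
  · exact absurd ((P i).getVert_mem_support k) hF
  · refine ⟨by omega, ?_, ?_⟩
    · by_contra hcon
      exact hF (Or.inl (getVert_mem_take_support _ hk (by omega)))
    · by_contra hcon
      refine hF (Or.inr ?_)
      change _ ∈ (P i).support.reverse.take _
      rw [← Walk.support_reverse]
      have := getVert_mem_take_support (P i).reverse (k := (P i).length - k) (m := ℓ / 2 - 1)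
        (by simp) (by omega)
      rwa [Walk.getVert_reverse, show (P i).length - ((P i).length - k) = k by omega] at this

theorem exists_getVert_of_adj
    (hi : ∀ i, InducedSeq G (P i).getVert (P i).length)
    (hm : ∀ i j, i ≠ j → Matched G (P i).getVert (P i).length (P j).getVert (P j).length)
    {i : Fin 3} {k : ℕ} (hk : 1 ≤ k) (hk' : k < (P i).length) {w : V} (hw : w ∈ prismSupport P)
    (hkw : G.Adj ((P i).getVert k) w) :
    ∃ l ≤ (P i).length, w = (P i).getVert l ∧ (l = k + 1 ∨ k = l + 1) := by
  obtain ⟨j, l, hl, rfl⟩ := mem_prismSupport.1 hw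
  by_cases hij : i = j
  · subst hij
    have := (hi i k l hk'.le hl).2.1 hkw
    exact ⟨l, hl, rfl, by omega⟩
  · have := (hm i j hij k l hk'.le hl).2.1 hkw
    omega

theorem prismGraph_adj (hi : ∀ i j, i ≠ j → G.Adj (a i) (a j))
    (hj : ∀ i j, i ≠ j → G.Adj (b i) (b j)) {u v : V} (h : (prismGraph G a b P).Adj u v) :
    G.Adj u v ∧ u ∈ prismSupport P ∧ v ∈ prismSupport P := by
  have hs : ∀ i, ∀ z ∈ (P i).support, z ∈ prismSupport P := fun i z hz =>
    Set.mem_iUnion.2 ⟨i, hz⟩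
  rw [prismGraph, SimpleGraph.fromEdgeSet_adj] at h
  rcases h.1 with (⟨i, j, hij, e⟩ | ⟨i, j, hij, e⟩) | ⟨i, e⟩
  · rw [Sym2.eq_iff] at e
    have h1 := hs i _ (P i).start_mem_support
    have h2 := hs j _ (P j).start_mem_support
    rcases e with ⟨rfl, rfl⟩ | ⟨rfl, rfl⟩
    · exact ⟨hi i j hij, h1, h2⟩
    · exact ⟨(hi i j hij).symm, h2, h1⟩
  · rw [Sym2.eq_iff] at e
    have h1 := hs i _ (P i).end_mem_support
    have h2 := hs j _ (P j).end_mem_support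
    rcases e with ⟨rfl, rfl⟩ | ⟨rfl, rfl⟩
    · exact ⟨hj i j hij, h1, h2⟩
    · exact ⟨(hj i j hij).symm, h2, h1⟩
  · exact ⟨(P i).adj_of_mem_edges e, hs i _ (Walk.fst_mem_support_of_mem_edges _ e),
      hs i _ (Walk.snd_mem_support_of_mem_edges _ e)⟩

theorem eq_or_adj_or_exists_adj {H : SimpleGraph V} {x y : V} (W : H.Walk x y) (hW : W.length ≤ 2)
    {u v : V} (hu : u ∈ W.support) (hv : v ∈ W.support) :
    u = v ∨ H.Adj u v ∨ ∃ w, H.Adj u w ∧ H.Adj w v := by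
  cases W with
  | nil =>
    simp only [Walk.support_nil, List.mem_singleton] at hu hv
    exact Or.inl (hu.trans hv.symm)
  | cons h W =>
    cases W with
    | nil =>
      simp only [Walk.support_cons, Walk.support_nil, List.mem_cons, List.not_mem_nil,
        or_false] at hu hv
      rcases hu with rfl | rfl <;> rcases hv with rfl | rfl <;> simp [h, h.symm]
    | cons h' W =>
      cases W with
      | nil =>
        simp only [Walk.support_cons, Walk.support_nil, List.mem_cons, List.not_mem_nil,
          or_false] at hu hv
        rcases hu with rfl | rfl | rfl <;> rcases hv with rfl | rfl | rfl <;>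
          first
          | exact Or.inl rfl
          | exact Or.inr (Or.inl h)
          | exact Or.inr (Or.inl h.symm)
          | exact Or.inr (Or.inl h')
          | exact Or.inr (Or.inl h'.symm)
          | exact Or.inr (Or.inr ⟨_, h, h'⟩)
          | exact Or.inr (Or.inr ⟨_, h'.symm, h.symm⟩)
      | cons h'' W =>
        simp only [Walk.length_cons] at hW
        omega

theorem Tidy.eq_and_le_of_not_kMajor (h : Tidy G ℓ P) (hℓ : 6 ≤ ℓ)
    (ha : ∀ i j, i ≠ j → G.Adj (a i) (a j)) (hb : ∀ i j, i ≠ j → G.Adj (b i) (b j))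
    (hi : ∀ i, InducedSeq G (P i).getVert (P i).length)
    (hm : ∀ i j, i ≠ j → Matched G (P i).getVert (P i).length (P j).getVert (P j).length)
    {z : V} (hz : z ∉ prismSupport P) (hK : ¬ KMajor G P z) {i j : Fin 3} {s t : ℕ}
    (hs : s ≤ (P i).length) (ht : t ≤ (P j).length) (hzs : G.Adj z ((P i).getVert s))
    (hzt : G.Adj z ((P j).getVert t)) : i = j ∧ t ≤ s + 2 := by
  obtain ⟨x, y, W, -, hW, hN⟩ := not_not.1 fun hcon => hK ⟨hz, hcon⟩
  have hds := h.le_of_adj hz hs hzs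
  have key : ∃ l ≤ (P i).length, (P j).getVert t = (P i).getVert l ∧ l ≤ s + 2 := by
    rcases eq_or_adj_or_exists_adj W hW (hN _ (mem_prismSupport.2 ⟨i, s, hs, rfl⟩) hzs)
      (hN _ (mem_prismSupport.2 ⟨j, t, ht, rfl⟩) hzt) with e | e | ⟨w, e, e'⟩
    · exact ⟨s, hs, e.symm, by omega⟩
    · have := prismGraph_adj ha hb e
      obtain ⟨l, hl, e, hl'⟩ := exists_getVert_of_adj hi hm (by omega) (by omega) this.2.2 this.1
      exact ⟨l, hl, e, by omega⟩
    · have := prismGraph_adj ha hb e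
      obtain ⟨l, hl, rfl, hl'⟩ := exists_getVert_of_adj hi hm (by omega) (by omega) this.2.2 this.1
      have := prismGraph_adj ha hb e'
      obtain ⟨l', hl'', e, hl''⟩ :=
        exists_getVert_of_adj hi hm (by omega) (by omega) this.2.2 this.1
      exact ⟨l', by omega, e, by omega⟩
  obtain ⟨l, hl, e, hl'⟩ := key
  by_cases hij : i = j
  · subst hij
    have := (hi i t l ht hl).1 e
    exact ⟨rfl, by omega⟩
  · exact absurd e.symm (hm i j hij l t hl ht).1

theorem sum_length_le_ncard_prismSupport [Finite V] (hP : ∀ i, (P i).IsPath)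
    (hd : ∀ i j, i ≠ j → ∀ x, x ∈ (P i).support → x ∉ (P j).support)
    {i j k : Fin 3} (hij : i ≠ j) (hik : i ≠ k) (hjk : j ≠ k) :
    (P i).length + (P j).length + (P k).length + 3 ≤ (prismSupport P).ncard := by
  classical
  have hc : ∀ i, (vset (P i)).ncard = (P i).length + 1 := by
    intro i
    have : vset (P i) = ↑(P i).support.toFinset := by ext z; simp [vset]
    rw [this, Set.ncard_coe_finset, List.toFinset_card_of_nodup (hP i).support_nodup,
      Walk.length_support]
  have hsub : vset (P i) ∪ vset (P j) ∪ vset (P k) ⊆ prismSupport P :=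
    Set.union_subset (Set.union_subset (Set.subset_iUnion (fun i => vset (P i)) i)
      (Set.subset_iUnion (fun i => vset (P i)) j)) (Set.subset_iUnion (fun i => vset (P i)) k)
  have h1 := Set.ncard_le_ncard hsub (Set.toFinite _)
  have h2 : Disjoint (vset (P i) ∪ vset (P j)) (vset (P k)) := Set.disjoint_union_left.2
    ⟨Set.disjoint_left.2 (hd i k hik), Set.disjoint_left.2 (hd j k hjk)⟩
  have h3 : Disjoint (vset (P i)) (vset (P j)) := Set.disjoint_left.2 (hd i j hij)
  rw [Set.ncard_union_eq h2, Set.ncard_union_eq h3, hc, hc, hc] at h1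
  omega

end Tidy

end LEH

/-- no short jump over a tidy shortest long near-prism in a prospect. -/
theorem prismjump {V : Type*} [Fintype V]
    (ℓ : ℕ) (hℓ : 6 ≤ ℓ) (hℓeven : Even ℓ)
    (G : SimpleGraph V) (hG : Prospect G ℓ)
    {a b : Fin 3 → V} (P : ∀ i : Fin 3, G.Walk (a i) (b i))
    (hsh : ShortestLNP G ℓ P) (htidy : Tidy G ℓ P) :
    ∀ i j : Fin 3, i ≠ j → ∀ x y : V, x ∈ (P i).support → y ∈ (P j).support →
      ∀ Q : G.Walk x y, IsInducedPath Q →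
        (∀ k, k ≠ i → k ≠ j → Anticomplete G (vset Q) (vset (P k))) →
        (∀ z ∈ inter Q, ¬ KMajor G P z) →
        ¬ (2 * Q.length ≤ 1 + min (P i).length (P j).length) := by
  intro i j hij x y hx hy Q hQ hQk hQm hlen
  have hthird : ∀ i j : Fin 3, i ≠ j → ∃ k, k ≠ i ∧ k ≠ j ∧ ∀ m, m = i ∨ m = j ∨ m = k := by
    decide
  obtain ⟨k, hki, hkj, hcov⟩ := hthird i j hij
  obtain ⟨⟨ha, hb, -, hP, hd, hhole⟩, hmin⟩ := hsh
  have hpos : ∀ i j, i ≠ j → 1 ≤ (P i).length + (P j).length := by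
    intro i j hij
    by_contra hcon
    exact hij (htidy.1 i j (by omega) (by omega))
  have hind : ∀ i, InducedSeq G (P i).getVert (P i).length := by
    intro i
    obtain ⟨j, hij⟩ := exists_ne i
    exact inducedSeq_getVert (hP i) (hP j) (hd i j hij.symm) (ha i j hij.symm) (hb i j hij.symm)
      (hpos i j hij.symm) (hhole i j hij.symm)
  have hmat : ∀ i j, i ≠ j → Matched G (P i).getVert (P i).length (P j).getVert (P j).length :=
    fun i j hij => matched_getVert (hP i) (hP j) (hd i j hij) (ha i j hij) (hb i j hij)
      (hpos i j hij) (hhole i j hij)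
  have hK : ∀ i, ∀ z ∈ (P i).support, z ∈ prismSupport P := fun i z hz =>
    Set.mem_iUnion.2 ⟨i, hz⟩
  obtain ⟨L, q, hL, h0, hqL, hqX, hq, hqA, hqB, hA, hB⟩ :=
    exists_shortest_inducedSeq (A := vset (P i)) (B := vset (P j))
      (X := {z | (∀ w ∈ vset (P k), z ≠ w ∧ ¬ G.Adj z w) ∧ ¬ KMajor G P z}) hx hy Q (by
      intro z hz
      refine ⟨fun w hw => hQk k hki hkj hz hw, ?_⟩
      by_cases hzx : z = x
      · exact fun h => h.1 (hzx ▸ hK i x hx)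
      by_cases hzy : z = y
      · exact fun h => h.1 (hzy ▸ hK j y hy)
      exact hQm z ⟨hz, hzx, hzy⟩)
  obtain ⟨x', hqx, hx'⟩ := Walk.mem_support_iff_exists_getVert.1 h0
  obtain ⟨y', hqy, hy'⟩ := Walk.mem_support_iff_exists_getVert.1 hqL
  have hends : ∀ i, i ≠ k → ∀ s ≤ (P i).length,
      (∀ w ∈ vset (P k), (P i).getVert s ≠ w ∧ ¬ G.Adj ((P i).getVert s) w) →
      s ≠ 0 ∧ s ≠ (P i).length := by
    intro i hik s hs hsk
    constructor
    · rintro rfl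
      exact (hsk _ ((P k).getVert_mem_support 0)).2
        ((hmat i k hik 0 0 (by omega) (by omega)).2.2 (Or.inl ⟨rfl, rfl⟩))
    · rintro rfl
      exact (hsk _ ((P k).getVert_mem_support (P k).length)).2
        ((hmat i k hik _ _ le_rfl le_rfl).2.2 (Or.inr ⟨rfl, rfl⟩))
  have hmemX : ∀ i, i ≠ k → ∀ s, s ≠ 0 → s < (P i).length → (P i).getVert s ∈
      {z | (∀ w ∈ vset (P k), z ≠ w ∧ ¬ G.Adj z w) ∧ ¬ KMajor G P z} := by
    intro i hik s hs hs'
    refine ⟨fun w hw => ?_, fun h => h.1 (hK i _ ((P i).getVert_mem_support s))⟩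
    obtain ⟨t, rfl, ht⟩ := Walk.mem_support_iff_exists_getVert.1 hw
    have := hmat i k hik s t hs'.le ht
    exact ⟨this.1, fun e => by have := this.2.1 e; omega⟩
  have hx'' := hends i hki.symm x' hx' (hqx ▸ (hqX 0 (by omega)).1)
  have hout : ∀ l, 1 ≤ l → l < L → q l ∉ prismSupport P := by
    intro l hl hl' hmem
    obtain ⟨m, hm⟩ := Set.mem_iUnion.1 hmem
    rcases hcov m with rfl | rfl | rfl
    · exact hqA l hl hl'.le hm
    · exact hqB l hl' hm
    · exact ((hqX l hl'.le).1 _ hm).1 rfl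
  have hadj0 : 1 ≤ L → G.Adj (q 1) ((P i).getVert x') := fun h => by
    rw [hqx]; exact (hq 1 0 h (by omega)).2.2 (by omega)
  have hadjL : 1 ≤ L → G.Adj (q (L - 1)) ((P j).getVert y') := fun h => by
    rw [hqy]; exact (hq _ _ (by omega) le_rfl).2.2 (by omega)
  have hL3 : 3 ≤ L := by
    by_contra hcon
    rcases (by omega : L = 0 ∨ L = 1 ∨ L = 2) with rfl | rfl | rfl
    · exact hd i j hij _ h0 hqL
    · have h1 := hadj0 le_rfl
      rw [← hqy] at h1
      have := (hmat j i hij.symm y' x' hy' hx').2.1 h1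
      omega
    · exact hij (htidy.eq_and_le_of_not_kMajor hℓ ha hb hind hmat (hout 1 le_rfl (by omega))
        (hqX 1 (by omega)).2 hx' hy' (hadj0 (by omega)) (hadjL (by omega))).1
  have h2d : 2 * (ℓ / 2 - 1) + 2 = ℓ := by
    obtain ⟨m, rfl⟩ := hℓeven
    omega
  have J : IsJump G (ℓ / 2 - 1) (P i).getVert (P i).length (P j).getVert (P j).length
      (P k).getVert (P k).length q L :=
    { ind₁ := hind i
      ind₂ := hind j
      ind₃ := hind k
      matched₁₂ := hmat i j hij
      matched₁₃ := hmat i k hki.symm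
      matched₂₃ := hmat j k hkj.symm
      ind := hq
      two_le := by omega
      three_le := hL3
      fst := by
        intro l s hl hl' hs
        refine ⟨fun e => hout l hl hl' (e ▸ hK i _ ((P i).getVert_mem_support s)), fun e => ?_⟩
        have h1 := htidy.le_of_adj (hout l hl hl') hs e
        have h2 : ¬ 2 ≤ l := fun h2 => hA l h2 hl'.le _ ((P i).getVert_mem_support s)
          (hmemX i hki.symm s (by omega) (by omega)) e
        omega
      snd := by
        intro l s hl hl' hs
        refine ⟨fun e => hout l hl hl' (e ▸ hK j _ ((P j).getVert_mem_support s)), fun e => ?_⟩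
        have h1 := htidy.le_of_adj (hout l hl hl') hs e
        have h2 : ¬ l + 2 ≤ L := fun h2 => hB l h2 _ ((P j).getVert_mem_support s)
          (hmemX j hkj.symm s (by omega) (by omega)) e
        omega
      trd := fun l s hl hl' hs => (hqX l hl'.le).1 _ ((P k).getVert_mem_support s) }
  have hspan : ∀ l, 1 ≤ l → l < L → ∀ i, ∀ s ≤ (P i).length, G.Adj (q l) ((P i).getVert s) →
      ∃ f g, NbrSpan G (q l) (P i).getVert (P i).length f g ∧ g ≤ f + 2 :=
    fun l hl hl' i s hs e => exists_nbrSpan hs e fun s t hs ht es et =>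
      (htidy.eq_and_le_of_not_kMajor hℓ ha hb hind hmat (hout l hl hl') (hqX l hl'.le).2
        hs ht es et).2
  obtain ⟨f₁, g₁, h₁, h₁'⟩ := hspan 1 le_rfl (by omega) i x' hx' (hadj0 (by omega))
  obtain ⟨f₂, g₂, h₂, h₂'⟩ := hspan (L - 1) (by omega) (by omega) j y' hy' (hadjL (by omega))
  have hfinal := J.lt_two_mul_length h₁ h₂ h₁' h₂' hx' hqx.symm hy' hqy.symm
    (fun a' b' P' hP' => (sum_length_le_ncard_prismSupport hP hd hij hki.symm hkj.symm).trans
      (hmin a' b' P' (h2d ▸ hP')))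
    (h2d.symm ▸ hG.2.2.1) (h2d.symm ▸ hG.2.2.2)
  omega
end

section
/- Let K be a tidy shortest long near-prism in a graph G. If x is a K-major vertex, then x has neighbours in at least two of the three constituent paths of K. -/
open SimpleGraph

open LEH

namespace LEH

section

variable {V : Type*} {G : SimpleGraph V} {u v c d : V}

lemma exists_shortcut {p : G.Walk u v} (hp : IsInducedPath p) {x : V} (hx : x ∉ p.support)
    {s t : ℕ} (hst : s + 3 ≤ t) (ht : t ≤ p.length)
    (hxs : G.Adj x (p.getVert s)) (hxt : G.Adj x (p.getVert t))
    (hn : ∀ n ≤ p.length, G.Adj x (p.getVert n) → s ≤ n ∧ n ≤ t) :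
    ∃ p' : G.Walk u v, IsInducedPath p' ∧ p'.length = s + 2 + (p.length - t) ∧
      ∀ z ∈ p'.support, z = x ∨
        z ∈ p.support ∧ z ≠ p.getVert (s + 1) ∧ z ≠ p.getVert (s + 2) := by
  obtain ⟨hpath, hind⟩ := hp
  have inj : ∀ m n, m ≤ p.length → n ≤ p.length → p.getVert m = p.getVert n → m = n :=
    fun m n hm hn h => hpath.getVert_injOn hm hn h
  have mem_take : ∀ z, z ∈ (p.take s).support → ∃ n ≤ s, p.getVert n = z := by
    intro z hz
    obtain ⟨n, rfl, hn⟩ := Walk.mem_support_iff_exists_getVert.1 hz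
    exact ⟨s ⊓ n, by omega, by rw [Walk.take_getVert]⟩
  have mem_drop : ∀ z, z ∈ (p.drop t).support → ∃ n, t ≤ n ∧ n ≤ p.length ∧ p.getVert n = z := by
    intro z hz
    obtain ⟨n, rfl, hn⟩ := Walk.mem_support_iff_exists_getVert.1 hz
    rw [Walk.drop_length] at hn
    exact ⟨t + n, by omega, by omega, by rw [Walk.drop_getVert]⟩
  have hx' : ∀ n, p.getVert n ≠ x := fun n h => hx (h ▸ p.getVert_mem_support n)
  let q : G.Walk (p.getVert s) v := .cons hxs.symm (.cons hxt (p.drop t))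
  have hsupp : ∀ z, z ∈ ((p.take s).append q).support ↔
      z ∈ (p.take s).support ∨ z = x ∨ z ∈ (p.drop t).support := by
    intro z
    have := (p.take s).end_mem_support
    simp only [q, Walk.mem_support_append_iff, Walk.support_cons, List.mem_cons]
    grind
  have hedge : ∀ e, e ∈ ((p.take s).append q).edges ↔
      e ∈ (p.take s).edges ∨ e = s(p.getVert s, x) ∨ e = s(x, p.getVert t) ∨
        e ∈ (p.drop t).edges := by
    intro e
    simp only [q, Walk.edges_append, Walk.edges_cons, List.mem_append, List.mem_cons]
  have hpos : ∀ z, z ∈ ((p.take s).append q).support → z = x ∨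
      ∃ n, n ≤ p.length ∧ (n ≤ s ∨ t ≤ n) ∧ p.getVert n = z := by
    intro z hz
    rcases (hsupp z).1 hz with h | h | h
    · obtain ⟨n, h1, h2⟩ := mem_take z h
      exact .inr ⟨n, by omega, .inl h1, h2⟩
    · exact .inl h
    · obtain ⟨n, h1, h2, h3⟩ := mem_drop z h
      exact .inr ⟨n, h2, .inr h1, h3⟩
  have hxe : ∀ w ∈ ((p.take s).append q).support, G.Adj x w →
      s(x, w) ∈ ((p.take s).append q).edges := by
    intro w hw hxw
    rcases hpos w hw with rfl | ⟨n, h1, h2, rfl⟩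
    · exact (G.loopless.irrefl _ hxw).elim
    · have := hn n h1 hxw
      obtain rfl | rfl : n = s ∨ n = t := by omega
      · exact (hedge _).2 (.inr (.inl Sym2.eq_swap))
      · exact (hedge _).2 (.inr (.inr (.inl rfl)))
  refine ⟨(p.take s).append q, ⟨?_, ?_⟩, ?_, ?_⟩
  · rw [Walk.isPath_def, Walk.support_append, List.nodup_append']
    refine ⟨(hpath.take s).support_nodup, ?_, ?_⟩
    · simp only [q, Walk.support_cons, List.tail_cons, List.nodup_cons]
      refine ⟨fun h => ?_, (hpath.drop t).support_nodup⟩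
      obtain ⟨n, -, -, h⟩ := mem_drop x h
      exact hx' n h
    · intro z hz hz'
      obtain ⟨n, h1, rfl⟩ := mem_take z hz
      simp only [q, Walk.support_cons, List.tail_cons, List.mem_cons] at hz'
      rcases hz' with h | h
      · exact hx' n h
      · obtain ⟨m, h2, h3, h4⟩ := mem_drop _ h
        have := inj m n h3 (by omega) h4
        omega
  · intro z hz w hw hzw
    rcases hpos z hz with rfl | ⟨n, hn1, hn2, rfl⟩
    · exact hxe w hw hzw
    rcases hpos w hw with rfl | ⟨m, hm1, hm2, rfl⟩
    · rw [Sym2.eq_swap]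
      exact hxe _ hz hzw.symm
    have he := hind _ (p.getVert_mem_support n) _ (p.getVert_mem_support m) hzw
    obtain ⟨k, hk, hke⟩ := (p.mk_mem_edges_iff_exists).1 he
    have hkk : (k ≤ s ∨ t ≤ k) ∧ (k + 1 ≤ s ∨ t ≤ k + 1) := by
      rcases Sym2.eq_iff.1 hke with ⟨h1, h2⟩ | ⟨h1, h2⟩ <;>
      · have := inj _ _ (by omega) (by omega) h1
        have := inj _ _ (by omega) (by omega) h2
        omega
    rw [hedge, ← hke]
    obtain h | h : k + 1 ≤ s ∨ t ≤ k := by omega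
    · left
      rw [Walk.mk_mem_edges_iff_exists]
      refine ⟨k, by rw [Walk.take_length]; omega, ?_⟩
      rw [Walk.take_getVert, Walk.take_getVert, min_eq_right (by omega), min_eq_right h]
    · right; right; right
      rw [Walk.mk_mem_edges_iff_exists]
      refine ⟨k - t, by rw [Walk.drop_length]; omega, ?_⟩
      rw [Walk.drop_getVert, Walk.drop_getVert, ← add_assoc, Nat.add_sub_cancel' h]
  · simp only [q, Walk.length_append, Walk.length_cons, Walk.take_length, Walk.drop_length]
    omega
  · intro z hz
    rcases hpos z hz with h | ⟨n, h1, h2, rfl⟩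
    · exact .inl h
    · refine .inr ⟨p.getVert_mem_support n, fun h => ?_, fun h => ?_⟩ <;>
      · have := inj _ _ h1 (by omega) h
        omega

/-- The closed walk formed by two walks and the edges joining their corresponding ends. -/
def joinCycle (p : G.Walk u v) (q : G.Walk c d) (huc : G.Adj u c) (hvd : G.Adj v d) :
    G.Walk u u :=
  p.append (.cons hvd (q.reverse.concat huc.symm))

section joinCycle

variable {p : G.Walk u v} {q : G.Walk c d} {huc : G.Adj u c} {hvd : G.Adj v d}

lemma mem_support_joinCycle {z : V} :
    z ∈ (joinCycle p q huc hvd).support ↔ z ∈ p.support ∨ z ∈ q.support := by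
  have h1 := p.start_mem_support
  have h2 := p.end_mem_support
  simp only [joinCycle, Walk.mem_support_append_iff, Walk.support_cons, Walk.support_concat,
    Walk.support_reverse, List.mem_cons, List.mem_append, List.mem_reverse,
    List.not_mem_nil, or_false]
  grind

lemma mem_edges_joinCycle {e : Sym2 V} :
    e ∈ (joinCycle p q huc hvd).edges ↔
      e ∈ p.edges ∨ e = s(v, d) ∨ e ∈ q.edges ∨ e = s(c, u) := by
  simp [joinCycle, Walk.edges_append, Walk.edges_concat]

lemma length_joinCycle : (joinCycle p q huc hvd).length = p.length + q.length + 2 := by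
  simp [joinCycle]
  omega

lemma isCycle_joinCycle (hp : p.IsPath) (hq : q.IsPath) (hl : 1 ≤ p.length)
    (hdis : ∀ z ∈ p.support, z ∉ q.support) : (joinCycle p q huc hvd).IsCycle := by
  have huv : u ≠ v := by
    rintro rfl
    rw [(Walk.isPath_iff_nil.1 hp).length_eq_zero] at hl
    omega
  refine hp.isCycle_append ?_ ?_ (.inr ?_)
  · rw [Walk.cons_isPath_iff, Walk.concat_isPath_iff]
    refine ⟨⟨hq.reverse, ?_⟩, ?_⟩
    · simpa using hdis u p.start_mem_support
    · simpa [Walk.support_concat, huv.symm] using hdis v p.end_mem_support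
  · intro z hz hz'
    have hpn := hp.support_nodup
    rw [← Walk.cons_tail_support, List.nodup_cons] at hpn
    simp [Walk.support_concat] at hz'
    rcases hz' with h | rfl
    · exact hdis z (List.mem_of_mem_tail hz) h
    · exact hpn.1 hz
  · simp

lemma mem_edges_joinCycle_of_adj {ℓ : ℕ} (hp : p.IsPath) (hq : q.IsPath) (hl : 1 ≤ p.length)
    (hdis : ∀ z ∈ p.support, z ∉ q.support)
    (hole : IsLongHoleOn G ℓ (vset p ∪ vset q)) {z w : V}
    (hz : z ∈ p.support ∨ z ∈ q.support) (hw : w ∈ p.support ∨ w ∈ q.support)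
    (hzw : G.Adj z w) : s(z, w) ∈ (joinCycle p q huc hvd).edges := by
  obtain ⟨o, C, ⟨hC, -, hCi⟩, -, hS⟩ := hole
  have hmem : ∀ y, y ∈ C.support ↔ y ∈ p.support ∨ y ∈ q.support := by
    intro y
    simpa [vset] using Set.ext_iff.1 hS y
  have h1 := hC.ncard_neighborSet_toSubgraph_eq_two ((hmem z).2 hz)
  have h2 := (isCycle_joinCycle (huc := huc) (hvd := hvd) hp hq hl
    hdis).ncard_neighborSet_toSubgraph_eq_two (mem_support_joinCycle.2 hz)
  have hsub : (joinCycle p q huc hvd).toSubgraph.neighborSet z ⊆ C.toSubgraph.neighborSet z := by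
    intro y hy
    rw [Subgraph.mem_neighborSet] at hy ⊢
    have hy' := Walk.adj_toSubgraph_iff_mem_edges.1 hy
    rw [Walk.adj_toSubgraph_iff_mem_edges]
    exact hCi z ((hmem z).2 hz) y
      ((hmem y).2 (mem_support_joinCycle.1 (Walk.snd_mem_support_of_mem_edges _ hy'))) hy.adj_sub
  have heq := Set.eq_of_subset_of_ncard_le hsub (by omega) (Set.finite_of_ncard_ne_zero (by omega))
  rw [← Walk.adj_toSubgraph_iff_mem_edges, ← Subgraph.mem_neighborSet, heq,
    Subgraph.mem_neighborSet, Walk.adj_toSubgraph_iff_mem_edges]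
  exact hCi z ((hmem z).2 hz) w ((hmem w).2 hw) hzw

end joinCycle

lemma isInducedPath_of_isLongHoleOn {ℓ : ℕ} {p : G.Walk u v} {q : G.Walk c d}
    (huc : G.Adj u c) (hvd : G.Adj v d) (hp : p.IsPath) (hq : q.IsPath) (hl : 1 ≤ p.length)
    (hdis : ∀ z ∈ p.support, z ∉ q.support)
    (hole : IsLongHoleOn G ℓ (vset p ∪ vset q)) : IsInducedPath p := by
  refine ⟨hp, fun z hz w hw hzw => ?_⟩
  have hd := hdis d
  have hc := hdis c
  rcases mem_edges_joinCycle.1 (mem_edges_joinCycle_of_adj (huc := huc) (hvd := hvd)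
    hp hq hl hdis hole (.inl hz) (.inl hw) hzw) with h | h | h | h
  · exact h
  · have := q.end_mem_support
    grind [Sym2.eq_iff]
  · exact (hdis z hz (Walk.fst_mem_support_of_mem_edges _ h)).elim
  · have := q.start_mem_support
    grind [Sym2.eq_iff]

lemma IsLongHoleOn.replace_path {ℓ : ℕ} {p p' : G.Walk u v} {q : G.Walk c d}
    (hole : IsLongHoleOn G ℓ (vset p ∪ vset q))
    (huc : G.Adj u c) (hvd : G.Adj v d) (hp : p.IsPath) (hq : q.IsPath) (hl : 1 ≤ p.length)
    (hdis : ∀ z ∈ p.support, z ∉ q.support)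
    (hp' : IsInducedPath p') (hl' : 2 ≤ p'.length) (hℓ : ℓ ≤ p'.length)
    (hdis' : ∀ z ∈ p'.support, z ∉ q.support)
    (hadj : ∀ z ∈ p'.support, ∀ w ∈ q.support, G.Adj z w → z ∈ p.support) :
    IsLongHoleOn G ℓ (vset p' ∪ vset q) := by
  have hcross : ∀ z ∈ p'.support, ∀ w ∈ q.support, G.Adj z w →
      s(z, w) ∈ (joinCycle p' q huc hvd).edges := by
    intro z hz w hw hzw
    have hzp := hadj z hz w hw hzw
    have := mem_edges_joinCycle_of_adj (huc := huc) (hvd := hvd) hp hq hl hdis hole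
      (.inl hzp) (.inr hw) hzw
    rw [mem_edges_joinCycle] at this ⊢
    rcases this with h | h
    · exact (hdis w (Walk.snd_mem_support_of_mem_edges _ h) hw).elim
    · exact .inr h
  refine ⟨u, joinCycle p' q huc hvd,
    ⟨isCycle_joinCycle hp'.1 hq (by omega) hdis', ?_, ?_⟩, ?_, ?_⟩
  · rw [length_joinCycle]; omega
  · intro z hz w hw hzw
    rw [mem_support_joinCycle] at hz hw
    rcases hz with hz | hz <;> rcases hw with hw | hw
    · exact mem_edges_joinCycle.2 (.inl (hp'.2 z hz w hw hzw))
    · exact hcross z hz w hw hzw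
    · rw [Sym2.eq_swap]
      exact hcross w hw z hz hzw.symm
    · have := mem_edges_joinCycle_of_adj (huc := huc) (hvd := hvd) hp hq hl hdis hole
        (.inr hz) (.inr hw) hzw
      rw [mem_edges_joinCycle] at this ⊢
      rcases this with h | h
      · exact (hdis z (Walk.fst_mem_support_of_mem_edges _ h) hz).elim
      · exact .inr h
  · rw [length_joinCycle]; omega
  · ext z
    simp [mem_support_joinCycle, vset]

lemma IsLongNearPrism.update {ℓ : ℕ} {a b : Fin 3 → V} {P : ∀ i : Fin 3, G.Walk (a i) (b i)}
    (hP : IsLongNearPrism ℓ a b P) (i : Fin 3) (p : G.Walk (a i) (b i))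
    (hl : 1 ≤ (P i).length) (hp : IsInducedPath p) (hl' : 2 ≤ p.length) (hℓ : ℓ ≤ p.length)
    (hdis : ∀ j, j ≠ i → ∀ z ∈ p.support, z ∉ (P j).support)
    (hadj : ∀ j, j ≠ i → ∀ z ∈ p.support, ∀ w ∈ (P j).support, G.Adj z w → z ∈ (P i).support) :
    IsLongNearPrism ℓ a b (Function.update P i p) := by
  obtain ⟨ha, hb, hab, hpath, hd, hole⟩ := hP
  have key : ∀ j, j ≠ i → IsLongHoleOn G ℓ (vset p ∪ vset (P j)) := fun j hj =>
    (hole i j hj.symm).replace_path (ha i j hj.symm) (hb i j hj.symm) (hpath i) (hpath j) hl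
      (hd i j hj.symm) hp hl' hℓ (hdis j hj) (hadj j hj)
  refine ⟨ha, hb, hab, fun j => ?_, fun j k hjk z hz => ?_, fun j k hjk => ?_⟩
  · obtain rfl | hj := eq_or_ne j i
    · simpa using hp.1
    · simpa [hj] using hpath j
  · obtain rfl | hj := eq_or_ne j i
    · rw [Function.update_self] at hz
      rw [Function.update_of_ne hjk.symm]
      exact hdis k hjk.symm z hz
    · rw [Function.update_of_ne hj] at hz
      obtain rfl | hk := eq_or_ne k i
      · rw [Function.update_self]
        exact fun h => hdis j hj z h hz
      · rw [Function.update_of_ne hk]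
        exact hd j k hjk z hz
  · obtain rfl | hj := eq_or_ne j i
    · rw [Function.update_self, Function.update_of_ne hjk.symm]
      exact key k hjk.symm
    · rw [Function.update_of_ne hj]
      obtain rfl | hk := eq_or_ne k i
      · rw [Function.update_self, Set.union_comm]
        exact key j hj
      · rw [Function.update_of_ne hk]
        exact hole j k hjk

lemma getVert_mem_frameStar {ℓ : ℕ} {a b : Fin 3 → V} {P : ∀ i : Fin 3, G.Walk (a i) (b i)}
    {i : Fin 3} {n : ℕ} (hn : n ≤ (P i).length)
    (h : (P i).length ≤ ℓ - 1 ∨ n < ℓ / 2 - 1 ∨ (P i).length - n < ℓ / 2 - 1) :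
    (P i).getVert n ∈ frameStar ℓ P := by
  refine Set.mem_iUnion.2 ⟨i, ?_⟩
  split_ifs with hs
  · exact (P i).getVert_mem_support n
  rcases h.resolve_left hs with h | h
  · left
    change _ ∈ (P i).support.take (ℓ / 2 - 1)
    rw [Walk.getVert_eq_support_getElem _ hn, List.mem_take_iff_getElem]
    exact ⟨n, by simp; omega, rfl⟩
  · right
    change _ ∈ (P i).support.reverse.take (ℓ / 2 - 1)
    rw [Walk.getVert_eq_support_getElem _ hn, List.mem_take_iff_getElem]
    refine ⟨(P i).length - n, by simp; omega, ?_⟩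
    rw [List.getElem_reverse]
    congr 1
    simp
    omega

lemma KMajor.exists_adj {a b : Fin 3 → V} {P : ∀ i : Fin 3, G.Walk (a i) (b i)} {x : V}
    (hx : KMajor G P x) : ∃ i, ∃ y ∈ (P i).support, G.Adj x y := by
  by_contra! h
  refine hx.2 ⟨a 0, a 0, .nil, by simp, by simp, fun z hz hxz => ?_⟩
  obtain ⟨i, hi⟩ := Set.mem_iUnion.1 hz
  exact (h i z hi hxz).elim

lemma KMajor.add_three_le {a b : Fin 3 → V} {P : ∀ i : Fin 3, G.Walk (a i) (b i)} {x : V}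
    (hx : KMajor G P x) {i : Fin 3} (hP : (P i).IsPath)
    (hi : ∀ j, j ≠ i → ∀ y ∈ (P j).support, ¬ G.Adj x y) {s t : ℕ}
    (hn : ∀ n ≤ (P i).length, G.Adj x ((P i).getVert n) → s ≤ n ∧ n ≤ t) : s + 3 ≤ t := by
  by_contra! hst
  have hsub : ∀ e ∈ (((P i).drop s).take (t - s)).edges, e ∈ (prismGraph G a b P).edgeSet := by
    intro e he
    have he' : e ∈ (P i).edges :=
      (Walk.isSubwalk_drop (P i) s).edges_subset
        ((Walk.isSubwalk_take ((P i).drop s) (t - s)).edges_subset he)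
    rw [prismGraph, edgeSet_fromEdgeSet]
    exact ⟨.inr ⟨i, he'⟩, G.not_isDiag_of_mem_edgeSet ((P i).edges_subset_edgeSet he')⟩
  refine hx.2 ⟨_, _, (((P i).drop s).take (t - s)).transfer _ hsub,
    ((hP.drop s).take _).transfer _, ?_, fun z hz hxz => ?_⟩
  · rw [Walk.length_transfer, Walk.take_length]
    omega
  · rw [Walk.support_transfer]
    obtain ⟨j, hj⟩ := Set.mem_iUnion.1 hz
    obtain rfl : j = i := by
      by_contra hne
      exact hi j hne z hj hxz
    obtain ⟨n, rfl, hnl⟩ := Walk.mem_support_iff_exists_getVert.1 hj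
    have := hn n hnl hxz
    rw [Walk.mem_support_iff_exists_getVert]
    refine ⟨n - s, ?_, ?_⟩
    · rw [Walk.take_getVert, Walk.drop_getVert]
      congr 1
      omega
    · rw [Walk.take_length, Walk.drop_length]
      omega

lemma exists_first_last_neighbor (p : G.Walk u v) {x : V} (h : ∃ y ∈ p.support, G.Adj x y) :
    ∃ s t, t ≤ p.length ∧ G.Adj x (p.getVert s) ∧ G.Adj x (p.getVert t) ∧
      ∀ n ≤ p.length, G.Adj x (p.getVert n) → s ≤ n ∧ n ≤ t := by
  classical
  obtain ⟨y, hy, hxy⟩ := h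
  obtain ⟨m, rfl, hm⟩ := Walk.mem_support_iff_exists_getVert.1 hy
  have hne : ((Finset.range (p.length + 1)).filter fun n => G.Adj x (p.getVert n)).Nonempty :=
    ⟨m, by simp [hxy]; omega⟩
  obtain ⟨s, hs, hs'⟩ := Finset.exists_min_image _ id hne
  obtain ⟨t, ht, ht'⟩ := Finset.exists_max_image _ id hne
  simp only [Finset.mem_filter, Finset.mem_range, id] at hs hs' ht ht'
  exact ⟨s, t, by omega, hs.2, ht.2, fun n hn hxn =>
    ⟨hs' n ⟨by omega, hxn⟩, ht' n ⟨by omega, hxn⟩⟩⟩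

end

end LEH

/-- a `K`-major vertex has neighbours in at least two constituent paths
of a tidy shortest long near-prism `K`. -/
theorem kmajor_meets_two_paths {V : Type*} [Fintype V]
    (ℓ : ℕ) (hℓ : 6 ≤ ℓ) (hℓeven : Even ℓ)
    (G : SimpleGraph V)
    {a b : Fin 3 → V} (P : ∀ i : Fin 3, G.Walk (a i) (b i))
    (hsh : ShortestLNP G ℓ P) (htidy : Tidy G ℓ P)
    (x : V) (hx : KMajor G P x) :
    ∃ i j : Fin 3, i ≠ j ∧ (∃ y ∈ (P i).support, G.Adj x y) ∧
      (∃ y ∈ (P j).support, G.Adj x y) := by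
  by_contra! hcon
  obtain ⟨hP, hmin⟩ := hsh
  obtain ⟨i, hi⟩ := hx.exists_adj
  have hoth : ∀ j, j ≠ i → ∀ y ∈ (P j).support, ¬ G.Adj x y := by
    obtain ⟨y, hy, hxy⟩ := hi
    exact fun j hj => hcon i j hj.symm ⟨y, hy, hxy⟩
  obtain ⟨s, t, ht, hxs, hxt, hn⟩ := exists_first_last_neighbor (P i) hi
  have hst := hx.add_three_le (hP.2.2.2.1 i) hoth hn
  have hframe : ∀ n ≤ (P i).length, G.Adj x ((P i).getVert n) →
      ¬ ((P i).length ≤ ℓ - 1 ∨ n < ℓ / 2 - 1 ∨ (P i).length - n < ℓ / 2 - 1) :=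
    fun n hn hxn h => (htidy.2 (getVert_mem_frameStar hn h) hx.1).2 hxn.symm
  have hfs := hframe s (by omega) hxs
  have hft := hframe t ht hxt
  have hℓ2 := Nat.even_iff.1 hℓeven
  have hxi : ∀ j, x ∉ (P j).support := fun j h => hx.1 (Set.mem_iUnion.2 ⟨j, h⟩)
  obtain ⟨j, hj⟩ : ∃ j, j ≠ i := exists_ne i
  have hdis := hP.2.2.2.2.1
  have hind : IsInducedPath (P i) := isInducedPath_of_isLongHoleOn (hP.1 i j hj.symm)
    (hP.2.1 i j hj.symm) (hP.2.2.2.1 i) (hP.2.2.2.1 j) (by omega) (hdis i j hj.symm)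
    (hP.2.2.2.2.2 i j hj.symm)
  obtain ⟨p, hp, hlen, hsupp⟩ := exists_shortcut hind (hxi i) hst ht hxs hxt hn
  have hP' := hP.update i p (by omega) hp (by omega) (by omega)
    (fun j hj z hz => by
      rcases hsupp z hz with rfl | h
      · exact hxi j
      · exact hdis i j hj.symm z h.1)
    (fun j hj z hz w hw hzw => by
      rcases hsupp z hz with rfl | h
      · exact (hoth j hj w hw hzw).elim
      · exact h.1)
  refine absurd (hmin _ _ _ hP') (not_le.2 ?_)
  have hmem : ∀ n, (P i).getVert n ∈ prismSupport P :=
    fun n => Set.mem_iUnion.2 ⟨i, (P i).getVert_mem_support n⟩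
  have hsub : prismSupport (Function.update P i p) ⊆
      insert x (prismSupport P \ {(P i).getVert (s + 1), (P i).getVert (s + 2)}) := by
    intro z hz
    obtain ⟨k, hk⟩ := Set.mem_iUnion.1 hz
    obtain rfl | hki := eq_or_ne k i
    · rw [Function.update_self] at hk
      rcases hsupp z hk with rfl | ⟨h1, h2, h3⟩
      · exact .inl rfl
      · exact .inr ⟨Set.mem_iUnion.2 ⟨k, h1⟩, by simp [h2, h3]⟩
    · rw [Function.update_of_ne hki] at hk
      refine .inr ⟨Set.mem_iUnion.2 ⟨k, hk⟩, ?_⟩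
      rintro (rfl | rfl) <;> exact hdis k i hki _ hk ((P i).getVert_mem_support _)
  have hne : (P i).getVert (s + 1) ≠ (P i).getVert (s + 2) := fun h => by
    have := (hP.2.2.2.1 i).getVert_injOn (show s + 1 ≤ _ by omega) (show s + 2 ≤ _ by omega) h
    omega
  have hpair : {(P i).getVert (s + 1), (P i).getVert (s + 2)} ⊆ prismSupport P := by
    rintro z (rfl | rfl) <;> exact hmem _
  have h1 := Set.ncard_le_ncard hsub (Set.toFinite _)
  have h2 := Set.ncard_insert_le x
    (prismSupport P \ {(P i).getVert (s + 1), (P i).getVert (s + 2)})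
  have h3 := Set.ncard_sdiff_add_ncard_of_subset hpair (Set.toFinite _)
  rw [Set.ncard_pair hne] at h3
  omega
end

section
/- Let K be a tidy shortest long near-prism in a graph G, with constituent paths P1, P2, P3. For all distinct i, j ∈ {1,2,3}, if x is a K-major vertex with no neighbours in V(P_j), then x either has exactly one neighbour in V(P_i) or has two nonadjacent neighbours in V(P_i). -/
open SimpleGraph

namespace LEH

open scoped Classical

variable {V : Type*}

/-- Two vertex-disjoint walks whose starts are adjacent and whose ends are adjacent, with no
other edges of `G` between them, whose union has at least `max ℓ 4` vertices. -/
structure Linked (G : SimpleGraph V) (ℓ : ℕ) {a b c d : V} (P : G.Walk a b) (Q : G.Walk c d) :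
    Prop where
  disj : ∀ u ∈ P.support, u ∉ Q.support
  adj_start : G.Adj a c
  adj_end : G.Adj b d
  cross : ∀ u ∈ P.support, ∀ v ∈ Q.support, G.Adj u v → (u = a ∧ v = c) ∨ (u = b ∧ v = d)
  le_length : ℓ ≤ P.length + Q.length + 2
  four_le : 4 ≤ P.length + Q.length + 2

variable {G : SimpleGraph V} {ℓ : ℕ}

lemma Linked.symm {a b c d : V} {P : G.Walk a b} {Q : G.Walk c d} (h : Linked G ℓ P Q) :
    Linked G ℓ Q P where
  disj u hu hu' := h.disj u hu' hu
  adj_start := h.adj_start.symm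
  adj_end := h.adj_end.symm
  cross u hu v hv huv := by
    rcases h.cross v hv u hu huv.symm with h | h
    · exact .inl h.symm
    · exact .inr h.symm
  le_length := by have := h.le_length; omega
  four_le := by have := h.four_le; omega

/-- The closed walk through `P` and `Q`. -/
def closeUp {a b c d : V} (P : G.Walk a b) (Q : G.Walk c d) (h₁ : G.Adj a c) (h₂ : G.Adj b d) :
    G.Walk c c :=
  .cons h₁.symm (P.append (.cons h₂ Q.reverse))

section closeUp

variable {a b c d : V} {P : G.Walk a b} {Q : G.Walk c d} {h₁ : G.Adj a c} {h₂ : G.Adj b d}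

lemma mem_support_closeUp {x : V} :
    x ∈ (closeUp P Q h₁ h₂).support ↔ x ∈ P.support ∨ x ∈ Q.support := by
  have := Q.start_mem_support
  simp only [closeUp, Walk.support_cons, Walk.mem_support_append_iff, List.mem_cons,
    Walk.support_reverse, List.mem_reverse]
  have := P.end_mem_support
  grind

lemma mem_edges_closeUp {e : Sym2 V} :
    e ∈ (closeUp P Q h₁ h₂).edges ↔
      e = s(a, c) ∨ e = s(b, d) ∨ e ∈ P.edges ∨ e ∈ Q.edges := by
  simp only [closeUp, Walk.edges_cons, Walk.edges_append, List.mem_append, List.mem_cons,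
    Walk.edges_reverse, List.mem_reverse, Sym2.eq_swap (a := c)]
  grind

lemma length_closeUp : (closeUp P Q h₁ h₂).length = P.length + Q.length + 2 := by
  simp [closeUp]; omega

lemma isPath_append_cons (hP : P.IsPath) {e : V} {R : G.Walk d e} (hR : R.IsPath)
    (hdisj : ∀ u ∈ P.support, u ∉ R.support) (h : G.Adj b d) :
    (P.append (.cons h R)).IsPath := by
  rw [Walk.isPath_def, Walk.support_append, Walk.support_cons, List.tail_cons,
    List.nodup_append]
  exact ⟨hP.support_nodup, hR.support_nodup, fun u hu v hv huv => hdisj u hu (huv ▸ hv)⟩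

lemma isCycle_closeUp (hP : P.IsPath) (hQ : Q.IsPath) (hdisj : ∀ u ∈ P.support, u ∉ Q.support)
    (hlen : 1 ≤ P.length + Q.length) : (closeUp P Q h₁ h₂).IsCycle := by
  rw [closeUp, Walk.cons_isCycle_iff]
  refine ⟨isPath_append_cons hP hQ.reverse (by simpa using hdisj) h₂, fun he => ?_⟩
  have ha := P.start_mem_support
  have hc := Q.start_mem_support
  simp only [Walk.edges_append, List.mem_append, Walk.edges_cons, List.mem_cons,
    Walk.edges_reverse, List.mem_reverse] at he
  rcases he with he | he | he
  · exact hdisj _ (Walk.fst_mem_support_of_mem_edges _ he) hc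
  · rcases Sym2.eq_iff.1 he with ⟨rfl, rfl⟩ | ⟨rfl, rfl⟩
    · exact hdisj _ P.end_mem_support hc
    · have := Walk.length_eq_zero_iff.2 (Walk.isPath_iff_nil.1 hP)
      have := Walk.length_eq_zero_iff.2 (Walk.isPath_iff_nil.1 hQ)
      omega
  · exact hdisj _ ha (Walk.snd_mem_support_of_mem_edges _ he)

end closeUp

/-- A cycle spanning a long hole is itself a long hole. -/
lemma IsLongHoleOn.isHole_of_isCycle {S : Set V} (h : IsLongHoleOn G ℓ S) {u : V}
    {D : G.Walk u u} (hD : D.IsCycle) (hS : {x | x ∈ D.support} = S) :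
    IsHole D ∧ ℓ ≤ D.length := by
  obtain ⟨w, C, ⟨hC, hC4, hCi⟩, hCl, rfl⟩ := h
  have hlen : ∀ {v : V} {E : G.Walk v v}, E.IsCycle → {x | x ∈ E.support}.ncard = E.length := by
    intro v E hE
    have h1 : {x | x ∈ E.support} = (E.support.tail.toFinset : Set V) := by
      ext x
      simp only [Set.mem_ofPred_eq, List.coe_toFinset]
      rw [Walk.mem_support_iff]
      refine ⟨?_, .inr⟩
      rintro (rfl | h)
      · exact Walk.end_mem_tail_support (by simpa using hE.not_nil)
      · exact h
    rw [h1, Set.ncard_coe_finset, List.toFinset_card_of_nodup hE.support_nodup]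
    simp
  have hCD : C.length = D.length := by rw [← hlen hC, ← hlen hD, hS]
  refine ⟨⟨hD, by omega, fun x hx y hy hxy => ?_⟩, by omega⟩
  have hmem : ∀ z, z ∈ D.support ↔ z ∈ C.support := fun z => Set.ext_iff.1 hS z
  have hsub : D.toSubgraph.neighborSet x ⊆ C.toSubgraph.neighborSet x := by
    intro z hz
    have hz' : s(x, z) ∈ D.edges := by
      rwa [← Walk.adj_toSubgraph_iff_mem_edges]
    have := hCi x ((hmem x).1 hx) z ((hmem z).1 (Walk.snd_mem_support_of_mem_edges _ hz'))
      (Walk.adj_of_mem_edges _ hz')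
    rwa [← Walk.adj_toSubgraph_iff_mem_edges] at this
  have hfin : (C.toSubgraph.neighborSet x).Finite :=
    Set.finite_of_ncard_ne_zero (by
      rw [hC.ncard_neighborSet_toSubgraph_eq_two ((hmem x).1 hx)]; norm_num)
  have heq := Set.eq_of_subset_of_ncard_le hsub (by
    rw [hC.ncard_neighborSet_toSubgraph_eq_two ((hmem x).1 hx),
      hD.ncard_neighborSet_toSubgraph_eq_two hx]) hfin
  have hyC : y ∈ C.toSubgraph.neighborSet x := by
    have := hCi x ((hmem x).1 hx) y ((hmem y).1 hy) hxy
    rwa [← Walk.adj_toSubgraph_iff_mem_edges] at this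
  rw [← heq] at hyC
  rwa [← Walk.adj_toSubgraph_iff_mem_edges]

section Linked

variable {a b c d : V} {P : G.Walk a b} {Q : G.Walk c d}

lemma Linked.isLongHoleOn (h : Linked G ℓ P Q) (hP : IsInducedPath P) (hQ : IsInducedPath Q) :
    IsLongHoleOn G ℓ (vset P ∪ vset Q) := by
  have h4 := h.four_le
  refine ⟨c, closeUp P Q h.adj_start h.adj_end,
    ⟨isCycle_closeUp hP.1 hQ.1 h.disj (by omega), by rw [length_closeUp]; exact h4, ?_⟩,
    by rw [length_closeUp]; exact h.le_length, ?_⟩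
  · intro x hx y hy hxy
    rw [mem_support_closeUp] at hx hy
    rw [mem_edges_closeUp]
    rcases hx with hx | hx <;> rcases hy with hy | hy
    · exact .inr (.inr (.inl (hP.2 x hx y hy hxy)))
    · rcases h.cross x hx y hy hxy with ⟨rfl, rfl⟩ | ⟨rfl, rfl⟩ <;> simp
    · rcases h.cross y hy x hx hxy.symm with ⟨rfl, rfl⟩ | ⟨rfl, rfl⟩ <;> simp
    · exact .inr (.inr (.inr (hQ.2 x hx y hy hxy)))
  · ext x
    simp [mem_support_closeUp, vset]

lemma IsLongHoleOn.linked (hS : IsLongHoleOn G ℓ (vset P ∪ vset Q)) (hP : P.IsPath)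
    (hQ : Q.IsPath) (hdisj : ∀ u ∈ P.support, u ∉ Q.support) (h₁ : G.Adj a c)
    (h₂ : G.Adj b d) : Linked G ℓ P Q ∧ IsInducedPath P ∧ IsInducedPath Q := by
  have hlen : 1 ≤ P.length + Q.length := by
    by_contra! hlt
    obtain ⟨w, C, ⟨hC, hC4, hCi⟩, hCl, hCs⟩ := hS
    have hP0 : P.length = 0 := by omega
    have hQ0 : Q.length = 0 := by omega
    obtain rfl := Walk.eq_of_length_eq_zero hP0
    obtain rfl := Walk.eq_of_length_eq_zero hQ0
    obtain rfl := (Walk.length_eq_zero_iff.1 hP0).eq_nil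
    obtain rfl := (Walk.length_eq_zero_iff.1 hQ0).eq_nil
    have hsub : C.support.tail.toFinset ⊆ {a, c} := by
      intro x hx
      have : x ∈ ({x | x ∈ C.support} : Set V) := List.mem_of_mem_tail (by simpa using hx)
      rw [hCs] at this
      simpa [vset, or_comm] using this
    have := (Finset.card_le_card hsub).trans Finset.card_le_two
    rw [List.toFinset_card_of_nodup hC.support_nodup] at this
    simp at this
    omega
  obtain ⟨⟨-, h4, hind⟩, hl⟩ := hS.isHole_of_isCycle (D := closeUp P Q h₁ h₂)
    (isCycle_closeUp hP hQ hdisj hlen) (by ext x; simp [mem_support_closeUp, vset])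
  rw [length_closeUp] at h4 hl
  simp only [mem_support_closeUp, mem_edges_closeUp, Sym2.eq_iff] at hind
  have hPs := fun u v (h : s(u, v) ∈ P.edges) => And.intro
    (Walk.fst_mem_support_of_mem_edges _ h) (Walk.snd_mem_support_of_mem_edges _ h)
  have hQs := fun u v (h : s(u, v) ∈ Q.edges) => And.intro
    (Walk.fst_mem_support_of_mem_edges _ h) (Walk.snd_mem_support_of_mem_edges _ h)
  have := P.start_mem_support
  have := P.end_mem_support
  have := Q.start_mem_support
  have := Q.end_mem_support
  refine ⟨⟨hdisj, h₁, h₂, fun u hu v hv huv => ?_, hl, h4⟩,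
    ⟨hP, fun u hu v hv huv => ?_⟩, ⟨hQ, fun u hu v hv huv => ?_⟩⟩
  · have := hind u (.inl hu) v (.inr hv) huv
    grind
  · have := hind u (.inl hu) v (.inl hv) huv
    grind
  · have := hind u (.inr hu) v (.inr hv) huv
    grind

end Linked

lemma exists_two_ne (k : Fin 3) : ∃ i j : Fin 3, i ≠ j ∧ i ≠ k ∧ j ≠ k := by
  decide +revert

lemma exists_third {i j : Fin 3} (h : i ≠ j) :
    ∃ k, i ≠ k ∧ j ≠ k ∧ ∀ m, m = i ∨ m = j ∨ m = k := by
  decide +revert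

lemma IsInducedPath.nil (x : V) : IsInducedPath (Walk.nil : G.Walk x x) :=
  ⟨.nil, by simp⟩

lemma IsInducedPath.reverse {u v : V} {P : G.Walk u v} (h : IsInducedPath P) :
    IsInducedPath P.reverse :=
  ⟨h.1.reverse, by simpa using h.2⟩

lemma IsInducedPath.append_cons {u v w t : V} {P : G.Walk u v} {Q : G.Walk w t}
    (hP : IsInducedPath P) (hQ : IsInducedPath Q) (hdisj : ∀ x ∈ P.support, x ∉ Q.support)
    (h : G.Adj v w) (hcross : ∀ x ∈ P.support, ∀ y ∈ Q.support, G.Adj x y → x = v ∧ y = w) :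
    IsInducedPath (P.append (.cons h Q)) := by
  refine ⟨isPath_append_cons hP.1 hQ.1 hdisj h, fun x hx y hy hxy => ?_⟩
  have hv := P.end_mem_support
  simp only [Walk.mem_support_append_iff, Walk.support_cons, List.mem_cons] at hx hy
  simp only [Walk.edges_append, Walk.edges_cons, List.mem_append, List.mem_cons]
  have hx' : x ∈ P.support ∨ x ∈ Q.support := by grind
  have hy' : y ∈ P.support ∨ y ∈ Q.support := by grind
  rcases hx' with hx | hx <;> rcases hy' with hy | hy
  · exact .inl (hP.2 x hx y hy hxy)
  · obtain ⟨rfl, rfl⟩ := hcross x hx y hy hxy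
    simp
  · obtain ⟨rfl, rfl⟩ := hcross y hy x hx hxy.symm
    simp [Sym2.eq_swap]
  · exact .inr (.inr (hQ.2 x hx y hy hxy))

lemma eq_of_mem_append {u v w x : V} {A : G.Walk u v} {B : G.Walk v w}
    (h : (A.append B).IsPath) (hA : x ∈ A.support) (hB : x ∈ B.support) : x = v := by
  rw [Walk.isPath_def, Walk.support_append, List.nodup_append] at h
  rcases (Walk.mem_support_iff _).1 hB with rfl | hB
  · rfl
  · exact (h.2.2 x hA x hB rfl).elim

lemma IsInducedPath.of_append_left {u v w : V} {A : G.Walk u v} {B : G.Walk v w}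
    (h : IsInducedPath (A.append B)) : IsInducedPath A := by
  refine ⟨h.1.of_append_left, fun x hx y hy hxy => ?_⟩
  have := h.2 x ((Walk.mem_support_append_iff _ _).2 (.inl hx)) y
    ((Walk.mem_support_append_iff _ _).2 (.inl hy)) hxy
  rw [Walk.edges_append, List.mem_append] at this
  refine this.resolve_right fun hB => hxy.ne ?_
  rw [eq_of_mem_append h.1 hx (Walk.fst_mem_support_of_mem_edges _ hB),
    eq_of_mem_append h.1 hy (Walk.snd_mem_support_of_mem_edges _ hB)]

lemma IsInducedPath.of_append_right {u v w : V} {A : G.Walk u v} {B : G.Walk v w}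
    (h : IsInducedPath (A.append B)) : IsInducedPath B := by
  have := h.reverse
  rw [Walk.reverse_append] at this
  simpa using this.of_append_left.reverse

/-- A walk meeting the neighbourhood of `x` splits at its first neighbour of `x`. -/
lemma exists_first_neighbor (x : V) {u v : V} (P : G.Walk u v)
    (h : ∃ z ∈ P.support, G.Adj x z) :
    ∃ (y : V) (A : G.Walk u y) (B : G.Walk y v), P = A.append B ∧ G.Adj x y ∧
      ∀ z ∈ A.support, G.Adj x z → z = y := by
  induction P with
  | nil =>
    obtain ⟨z, hz, hxz⟩ := h
    obtain rfl := by simpa using hz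
    exact ⟨_, .nil, .nil, rfl, hxz, by simp⟩
  | @cons u w v huw P ih =>
    by_cases hu : G.Adj x u
    · exact ⟨u, .nil, .cons huw P, rfl, hu, by simp⟩
    · obtain ⟨y, A, B, rfl, hy, hA⟩ := ih (by
        obtain ⟨z, hz, hxz⟩ := h
        rcases List.mem_cons.1 (Walk.support_cons huw P ▸ hz) with rfl | hz
        · exact (hu hxz).elim
        · exact ⟨z, hz, hxz⟩)
      refine ⟨y, .cons huw A, B, rfl, hy, fun z hz hxz => ?_⟩
      rcases List.mem_cons.1 (Walk.support_cons huw A ▸ hz) with rfl | hz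
      · exact (hu hxz).elim
      · exact hA z hz hxz

/-- A walk meeting the neighbourhood of `x` splits at its last neighbour of `x`. -/
lemma exists_last_neighbor (x : V) {u v : V} (P : G.Walk u v)
    (h : ∃ z ∈ P.support, G.Adj x z) :
    ∃ (y : V) (A : G.Walk u y) (B : G.Walk y v), P = A.append B ∧ G.Adj x y ∧
      ∀ z ∈ B.support, G.Adj x z → z = y := by
  obtain ⟨y, A, B, hAB, hy, hA⟩ := exists_first_neighbor x P.reverse (by simpa using h)
  refine ⟨y, B.reverse, A.reverse, ?_, hy, by simpa using hA⟩
  rw [← Walk.reverse_append, ← hAB, Walk.reverse_reverse]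

lemma mem_take_of_length_lt {u y v : V} (A : G.Walk u y) (B : G.Walk y v) {n : ℕ}
    (h : A.length < n) : y ∈ (A.append B).support.take n := by
  rw [Walk.support_append, List.take_append]
  refine List.mem_append_left _ ?_
  rw [List.take_of_length_le (by simp; omega)]
  exact A.end_mem_support

section prism

variable {a b : Fin 3 → V} {P : ∀ i : Fin 3, G.Walk (a i) (b i)}

lemma prismSupport_eq_union {i j k : Fin 3} (hij : i ≠ j) (hik : i ≠ k) (hjk : j ≠ k) :
    prismSupport P = vset (P i) ∪ vset (P j) ∪ vset (P k) := by
  have h : ∀ m : Fin 3, m = i ∨ m = j ∨ m = k := by decide +revert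
  ext z
  simp only [prismSupport, Set.mem_iUnion, Set.mem_union]
  constructor
  · rintro ⟨m, hm⟩
    rcases h m with rfl | rfl | rfl <;> simp [hm]
  · rintro ((hz | hz) | hz) <;> exact ⟨_, hz⟩

lemma ncard_vset {u v : V} {Q : G.Walk u v} (hQ : Q.IsPath) : (vset Q).ncard = Q.length + 1 := by
  have : vset Q = (Q.support.toFinset : Set V) := by ext; simp [vset]
  rw [this, Set.ncard_coe_finset, List.toFinset_card_of_nodup hQ.support_nodup,
    Walk.length_support]

lemma ncard_prismSupport [Finite V] (hP : ∀ i, (P i).IsPath)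
    (hdisj : ∀ i j, i ≠ j → ∀ x, x ∈ (P i).support → x ∉ (P j).support)
    {i j k : Fin 3} (hij : i ≠ j) (hik : i ≠ k) (hjk : j ≠ k) :
    (prismSupport P).ncard = (P i).length + (P j).length + (P k).length + 3 := by
  rw [prismSupport_eq_union hij hik hjk, Set.ncard_union_eq, Set.ncard_union_eq,
    ncard_vset (hP i), ncard_vset (hP j), ncard_vset (hP k)]
  · omega
  · exact Set.disjoint_left.2 (hdisj i j hij)
  · rw [Set.disjoint_union_left]
    exact ⟨Set.disjoint_left.2 (hdisj i k hik), Set.disjoint_left.2 (hdisj j k hjk)⟩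

/-- Three pairwise linked induced paths form a long near-prism. -/
lemma isLongNearPrism_of_linked (hP : ∀ i, IsInducedPath (P i))
    (h : ∀ i j, i ≠ j → Linked G ℓ (P i) (P j)) : IsLongNearPrism ℓ a b P := by
  refine ⟨fun i j hij => (h i j hij).adj_start, fun i j hij => (h i j hij).adj_end, ?_,
    fun i => (hP i).1, fun i j hij => (h i j hij).disj,
    fun i j hij => (h i j hij).isLongHoleOn (hP i) (hP j)⟩
  have hlen : ∀ i j, a i = b j → i = j ∧ (P i).length = 0 := by
    intro i j hij
    obtain rfl : i = j := by
      by_contra hne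
      exact (h i j hne).disj (a i) (P i).start_mem_support
        (by rw [hij]; exact (P j).end_mem_support)
    refine ⟨rfl, ?_⟩
    have hp := (hP i).1
    generalize P i = Q at hp
    revert Q
    rw [hij]
    intro Q hp
    simp [Walk.isPath_iff_nil.1 hp]
  rintro _ ⟨⟨i, rfl⟩, ⟨j, hj⟩⟩ _ ⟨⟨k, rfl⟩, ⟨m, hm⟩⟩
  by_contra hne
  have h4 := (h i k (by rintro rfl; exact hne rfl)).four_le
  have := (hlen i j hj.symm).2
  have := (hlen k m hm.symm).2
  omega

/-- No three pairwise linked induced paths are shorter than a shortest long near-prism. -/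
lemma ShortestLNP.length_le [Finite V] (hsh : ShortestLNP G ℓ P)
    {i j k : Fin 3} (hij : i ≠ j) (hik : i ≠ k) (hjk : j ≠ k)
    {a₀ a₁ a₂ b₀ b₁ b₂ : V} {Q₀ : G.Walk a₀ b₀} {Q₁ : G.Walk a₁ b₁} {Q₂ : G.Walk a₂ b₂}
    (h₀ : IsInducedPath Q₀) (h₁ : IsInducedPath Q₁) (h₂ : IsInducedPath Q₂)
    (h₀₁ : Linked G ℓ Q₀ Q₁) (h₀₂ : Linked G ℓ Q₀ Q₂) (h₁₂ : Linked G ℓ Q₁ Q₂) :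
    (P i).length + (P j).length + (P k).length ≤ Q₀.length + Q₁.length + Q₂.length := by
  obtain ⟨⟨-, -, -, hp, hd, -⟩, hmin⟩ := hsh
  let Q : ∀ m : Fin 3, G.Walk (![a₀, a₁, a₂] m) (![b₀, b₁, b₂] m) := fun m =>
    match m with
    | 0 => Q₀
    | 1 => Q₁
    | 2 => Q₂
  have hQ : IsLongNearPrism ℓ _ _ Q := by
    apply isLongNearPrism_of_linked
    · intro m
      fin_cases m
      exacts [h₀, h₁, h₂]
    · intro m n hmn
      fin_cases m <;> fin_cases n
      exacts [(hmn rfl).elim, h₀₁, h₀₂, h₀₁.symm, (hmn rfl).elim, h₁₂, h₀₂.symm, h₁₂.symm,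
        (hmn rfl).elim]
  have hle := hmin _ _ Q hQ
  rw [ncard_prismSupport hp hd hij hik hjk,
    ncard_prismSupport hQ.2.2.2.1 hQ.2.2.2.2.1 (i := 0) (j := 1) (k := 2) (by decide)
      (by decide) (by decide)] at hle
  change _ ≤ Q₀.length + Q₁.length + Q₂.length + 3 at hle
  omega

lemma IsLongNearPrism.linked (h : IsLongNearPrism ℓ a b P) {i j : Fin 3} (hij : i ≠ j) :
    Linked G ℓ (P i) (P j) ∧ IsInducedPath (P i) ∧ IsInducedPath (P j) :=
  (h.2.2.2.2.2 i j hij).linked (h.2.2.2.1 i) (h.2.2.2.1 j) (h.2.2.2.2.1 i j hij)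
    (h.1 i j hij) (h.2.1 i j hij)

/-- In a tidy near-prism, a neighbour of an outside vertex is far from the ends of its path. -/
lemma Tidy.le_length (h : Tidy G ℓ P) {x : V} (hx : x ∉ prismSupport P) {i : Fin 3} {y : V}
    {A : G.Walk (a i) y} {B : G.Walk y (b i)} (hAB : P i = A.append B) (hy : G.Adj x y) :
    ℓ / 2 - 1 ≤ A.length ∧ ℓ / 2 - 1 ≤ B.length := by
  have hnot : y ∉ frameStar ℓ P := fun hmem => (h.2 hmem hx).2 hy.symm
  simp only [frameStar, Set.mem_iUnion, not_exists] at hnot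
  have hi := hnot i
  have hyP : y ∈ vset (P i) := by
    rw [hAB]
    exact (Walk.mem_support_append_iff _ _).2 (.inl A.end_mem_support)
  split_ifs at hi with hlen
  · exact (hi hyP).elim
  · simp only [Set.mem_union, Set.mem_ofPred_eq, not_or] at hi
    rw [hAB, ← Walk.support_reverse, Walk.reverse_append] at hi
    constructor
    · by_contra! hlt
      exact hi.1 (mem_take_of_length_lt A B hlt)
    · by_contra! hlt
      exact hi.2 (mem_take_of_length_lt B.reverse A.reverse (by simpa using hlt))

/-- A major vertex has a neighbour outside any short subpath of a constituent path. -/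
lemma KMajor.exists_notMem {x : V} (hx : KMajor G P x) {u v : V} (W : G.Walk u v) (i : Fin 3)
    (hW : ∀ e ∈ W.edges, e ∈ (P i).edges) (hpath : W.IsPath) (hlen : W.length ≤ 2) :
    ∃ m, ∃ z ∈ (P m).support, G.Adj x z ∧ z ∉ W.support := by
  by_contra! hcon
  have hW' : ∀ e ∈ W.edges, e ∈ (prismGraph G a b P).edgeSet := by
    intro e he
    rw [prismGraph, edgeSet_fromEdgeSet]
    exact ⟨.inr ⟨i, hW e he⟩, G.not_isDiag_of_mem_edgeSet (W.edges_subset_edgeSet he)⟩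
  refine hx.2 ⟨u, v, W.transfer _ hW', hpath.transfer hW', by simpa using hlen, ?_⟩
  intro z hz hxz
  obtain ⟨m, hm⟩ := Set.mem_iUnion.1 hz
  simpa using hcon m z hm hxz

lemma subset_edges_of_eq_append {u v w t : V} {P : G.Walk u t} {A : G.Walk u v} {M : G.Walk v w}
    {C : G.Walk w t} (h : P = A.append (M.append C)) : ∀ e ∈ M.edges, e ∈ P.edges := by
  intro e he
  simp [h, Walk.edges_append, he]

/-- A major vertex of a tidy shortest long near-prism has neighbours in at least two of the
constituent paths. -/
lemma KMajor.not_confined [Finite V] (hℓ : 6 ≤ ℓ) (hℓeven : Even ℓ) (hsh : ShortestLNP G ℓ P)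
    (htidy : Tidy G ℓ P) {x : V} (hx : KMajor G P x) (k : Fin 3)
    (hno : ∀ m, m ≠ k → ∀ z ∈ (P m).support, ¬ G.Adj x z) : False := by
  have hhalf := Nat.two_mul_div_two_of_even hℓeven
  have hnb : ∃ z ∈ (P k).support, G.Adj x z := by
    obtain ⟨m, z, hz, hxz, -⟩ := hx.exists_notMem (Walk.nil : G.Walk x x) k (by simp) .nil
      (by simp)
    obtain rfl : m = k := by
      by_contra hmk
      exact hno m hmk z hz hxz
    exact ⟨z, hz, hxz⟩
  obtain ⟨y, A, B, hAB, hy, hA⟩ := exists_first_neighbor x (P k) hnb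
  obtain ⟨z, M, C, rfl, hz, hC⟩ := exists_last_neighbor x B ⟨y, B.start_mem_support, hy⟩
  have hAlen := (htidy.le_length hx.1 hAB hy).1
  have hClen := (htidy.le_length hx.1 (hAB.trans (Walk.append_assoc _ _ _)) hz).2
  obtain ⟨i, j, h12, h1, h2⟩ := exists_two_ne k
  have hPk : IsInducedPath (P k) := (hsh.1.linked h1).2.2
  have hAMC : IsInducedPath (A.append (M.append C)) := hAB ▸ hPk
  have hAind := hAMC.of_append_left
  have hMC := hAMC.of_append_right
  have hMind := hMC.of_append_left
  have hCind := hMC.of_append_right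
  have hmem : ∀ w, w ∈ (P k).support ↔ w ∈ A.support ∨ w ∈ M.support ∨ w ∈ C.support := by
    intro w
    rw [hAB, Walk.mem_support_append_iff, Walk.mem_support_append_iff]
  have hxk : x ∉ (P k).support := fun h => hx.1 (Set.mem_iUnion.2 ⟨k, h⟩)
  have hMlen : 3 ≤ M.length := by
    by_contra! hlt
    obtain ⟨m, w, hw, hxw, hwM⟩ := hx.exists_notMem M k (subset_edges_of_eq_append hAB)
      hMind.1 (by omega)
    by_cases hmk : m = k
    · subst hmk
      rcases (hmem w).1 hw with hw | hw | hw
      · exact hwM (hA w hw hxw ▸ M.start_mem_support)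
      · exact hwM hw
      · exact hwM (hC w hw hxw ▸ M.end_mem_support)
    · exact hno m hmk w hw hxw
  have hyz : y ≠ z := by
    rintro rfl
    have := Walk.length_eq_zero_iff.2 (Walk.isPath_iff_nil.1 hMind.1)
    omega
  have hACdisj : ∀ u ∈ A.support, u ∉ C.support := by
    intro u hu hu'
    obtain rfl := eq_of_mem_append hAMC.1 hu ((Walk.mem_support_append_iff _ _).2 (.inr hu'))
    exact hyz (eq_of_mem_append hMC.1 M.start_mem_support hu')
  have hACcross : ∀ u ∈ A.support, ∀ v ∈ C.support, ¬ G.Adj u v := by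
    intro u hu v hv huv
    have he := hAMC.2 u ((Walk.mem_support_append_iff _ _).2 (.inl hu)) v (by simp [hv]) huv
    rw [Walk.edges_append, Walk.edges_append, List.mem_append, List.mem_append] at he
    rcases he with he | he | he
    · exact hACdisj v (Walk.snd_mem_support_of_mem_edges _ he) hv
    · obtain rfl := eq_of_mem_append hAMC.1 hu
        (by simp [Walk.fst_mem_support_of_mem_edges _ he])
      obtain rfl := eq_of_mem_append hMC.1 (Walk.snd_mem_support_of_mem_edges _ he) hv
      have := hMind.1.length_eq_one_of_mem_edges he
      omega
    · exact hACdisj u hu (Walk.fst_mem_support_of_mem_edges _ he)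
  have hxC : IsInducedPath ((Walk.nil : G.Walk x x).append (.cons hz C)) := by
    refine (IsInducedPath.nil x).append_cons hCind ?_ hz ?_
    · intro u hu
      obtain rfl : u = x := by simpa using hu
      exact fun h => hxk ((hmem _).2 (.inr (.inr h)))
    · intro u hu v hv huv
      obtain rfl : u = x := by simpa using hu
      exact ⟨rfl, hC v hv huv⟩
  have hN := hAind.append_cons hxC (by
    intro u hu
    simp only [Walk.nil_append, Walk.support_cons, List.mem_cons, not_or]
    exact ⟨fun h => hxk ((hmem _).2 (.inl (h ▸ hu))), hACdisj u hu⟩) hy.symm (by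
    intro u hu v hv huv
    simp only [Walk.nil_append, Walk.support_cons, List.mem_cons] at hv
    rcases hv with rfl | hv
    · exact ⟨hA u hu huv.symm, rfl⟩
    · exact (hACcross u hu v hv huv).elim)
  set N := A.append (.cons hy.symm ((Walk.nil : G.Walk x x).append (.cons hz C))) with hNdef
  have hNmem : ∀ w ∈ N.support, w = x ∨ w ∈ (P k).support := by
    intro w hw
    simp only [hNdef, Walk.mem_support_append_iff, Walk.nil_append, Walk.support_cons,
      List.mem_cons] at hw
    rw [hmem]
    have := A.end_mem_support
    grind
  have hNlen : N.length = A.length + C.length + 2 := by simp [hNdef]; omega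
  have hlink : ∀ m, m ≠ k → Linked G ℓ (P m) N := by
    intro m hmk
    have hl := (hsh.1.linked hmk).1
    refine ⟨fun u hu huN => ?_, hl.adj_start, hl.adj_end, fun u hu v hv huv => ?_, by omega,
      by omega⟩
    · rcases hNmem u huN with rfl | h
      · exact hx.1 (Set.mem_iUnion.2 ⟨m, hu⟩)
      · exact hl.disj u hu h
    · rcases hNmem v hv with rfl | h
      · exact (hno m hmk u hu huv.symm).elim
      · exact hl.cross u hu v h huv
  have hle := hsh.length_le h12 h1 h2 (hsh.1.linked h12).2.1 (hsh.1.linked h12).2.2 hN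
    (hsh.1.linked h12).1 (hlink _ h1) (hlink _ h2)
  have hPlen : (P k).length = A.length + M.length + C.length := by
    rw [hAB, Walk.length_append, Walk.length_append]; omega
  omega

/-- In a tidy shortest long near-prism, a vertex with neighbours in `P k` and none in `P j`
cannot have exactly two neighbours in `P i` that are consecutive. -/
lemma ShortestLNP.not_consecutive [Finite V] (hℓ : 6 ≤ ℓ) (hℓeven : Even ℓ)
    (hsh : ShortestLNP G ℓ P) (htidy : Tidy G ℓ P) {x : V} (hx : x ∉ prismSupport P)
    {i j k : Fin 3} (hij : i ≠ j) (hik : i ≠ k) (hjk : j ≠ k)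
    (hj : ∀ z ∈ (P j).support, ¬ G.Adj x z) (hk : ∃ z ∈ (P k).support, G.Adj x z)
    {c d : V} {A : G.Walk (a i) c} {D : G.Walk d (b i)} {hcd : G.Adj c d}
    (hi : P i = A.append (.cons hcd D)) (hxc : G.Adj x c) (hxd : G.Adj x d)
    (hA : ∀ z ∈ A.support, G.Adj x z → z = c) (hD : ∀ z ∈ D.support, G.Adj x z → z = d) :
    False := by
  have hhalf := Nat.two_mul_div_two_of_even hℓeven
  obtain ⟨y, Y, Z, hYZ, hy, hY⟩ := exists_first_neighbor x (P k) hk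
  obtain ⟨hYlen, hZlen⟩ := htidy.le_length hx hYZ hy
  have hAlen := (htidy.le_length hx hi hxc).1
  have hDlen := (htidy.le_length (A := A.append (.cons hcd .nil)) (B := D) hx
    (by simp [hi, ← Walk.append_assoc]) hxd).2
  obtain ⟨hlij, hPi, hPj⟩ := hsh.1.linked hij
  obtain ⟨hlik, -, hPk⟩ := hsh.1.linked hik
  obtain ⟨hljk, -, -⟩ := hsh.1.linked hjk
  have hACD : IsInducedPath (A.append (.cons hcd D)) := hi ▸ hPi
  have hYZind : IsInducedPath (Y.append Z) := hYZ ▸ hPk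
  have hAind := hACD.of_append_left
  have hYind := hYZind.of_append_left
  have hDind : IsInducedPath D := by
    have : A.append (.cons hcd D) = (A.append (.cons hcd .nil)).append D := by
      simp [← Walk.append_assoc]
    rw [this] at hACD
    exact hACD.of_append_right
  have hxP : ∀ m, x ∉ (P m).support := fun m h => hx (Set.mem_iUnion.2 ⟨m, h⟩)
  have hAi : ∀ w ∈ A.support, w ∈ (P i).support := by
    intro w hw; rw [hi, Walk.mem_support_append_iff]; exact .inl hw
  have hDi : ∀ w ∈ D.support, w ∈ (P i).support := by
    intro w hw; rw [hi, Walk.mem_support_append_iff]; simp [hw]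
  have hYk : ∀ w ∈ Y.support, w ∈ (P k).support := by
    intro w hw; rw [hYZ, Walk.mem_support_append_iff]; exact .inl hw
  have hcD : c ∉ D.support := fun h =>
    ((Walk.cons_isPath_iff _ _).1 hACD.1.of_append_right).2 h
  have hADdisj : ∀ u ∈ A.support, u ∉ D.support := by
    intro u hu hu'
    obtain rfl := eq_of_mem_append hACD.1 hu (by simp [hu'])
    exact hcD hu'
  have hADcross : ∀ u ∈ A.support, ∀ v ∈ D.support, G.Adj u v → u = c ∧ v = d := by
    intro u hu v hv huv
    have he := hPi.2 u (hAi u hu) v (hDi v hv) huv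
    rw [hi, Walk.edges_append, Walk.edges_cons, List.mem_append, List.mem_cons] at he
    rcases he with he | he | he
    · exact (hADdisj v (Walk.snd_mem_support_of_mem_edges _ he) hv).elim
    · rcases Sym2.eq_iff.1 he with h | ⟨rfl, rfl⟩
      · exact h
      · exact (hcD hv).elim
    · exact (hADdisj u hu (Walk.fst_mem_support_of_mem_edges _ he)).elim
  have hbiA : b i ∉ A.support := fun h => hADdisj _ h D.end_mem_support
  have haiD : a i ∉ D.support := hADdisj _ A.start_mem_support
  have hbkY : b k ∉ Y.support := by
    intro h
    have hby := eq_of_mem_append hYZind.1 h Z.end_mem_support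
    have hZ := hYZind.of_append_right.1
    subst hby
    have := Walk.length_eq_zero_iff.2 (Walk.isPath_iff_nil.1 hZ)
    omega
  have hYx := hYind.append_cons (IsInducedPath.nil x)
    (fun u hu hu' => hxP k (by
      obtain rfl : u = x := by simpa using hu'
      exact hYk _ hu)) hy.symm
    (fun u hu v hv huv => by
      obtain rfl : v = x := by simpa using hv
      exact ⟨hY u hu huv.symm, rfl⟩)
  have hjD := hPj.append_cons hDind.reverse
    (fun u hu hu' => hlij.disj u (hDi u (by simpa using hu')) hu) hlij.adj_end.symm
    (fun u hu v hv huv => by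
      rw [Walk.support_reverse, List.mem_reverse] at hv
      rcases hlij.cross v (hDi v hv) u hu huv.symm with ⟨rfl, rfl⟩ | ⟨rfl, rfl⟩
      · exact (haiD hv).elim
      · exact ⟨rfl, rfl⟩)
  set R := Y.append (.cons hy.symm (Walk.nil : G.Walk x x)) with hR
  set T := (P j).append (.cons hlij.adj_end.symm D.reverse) with hT
  have hRmem : ∀ w ∈ R.support, w = x ∨ w ∈ Y.support := by
    intro w hw
    simp only [hR, Walk.mem_support_append_iff, Walk.support_cons, Walk.support_nil,
      List.mem_cons, List.not_mem_nil, or_false] at hw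
    have := Y.end_mem_support
    grind
  have hTmem : ∀ w ∈ T.support, w ∈ (P j).support ∨ w ∈ D.support := by
    intro w hw
    simp only [hT, Walk.mem_support_append_iff, Walk.support_cons, Walk.support_reverse,
      List.mem_cons, List.mem_reverse] at hw
    have := (P j).end_mem_support
    grind
  have hRlen : R.length = Y.length + 1 := by simp [hR]
  have hTlen : T.length = (P j).length + D.length + 1 := by simp [hT]; omega
  have hPilen : (P i).length = A.length + D.length + 1 := by
    rw [hi, Walk.length_append, Walk.length_cons]; omega
  have hPklen : (P k).length = Y.length + Z.length := by rw [hYZ, Walk.length_append]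
  have hAR : Linked G ℓ A R := by
    refine ⟨fun u hu huR => ?_, hlik.adj_start, hxc.symm, fun u hu v hv huv => ?_, by omega,
      by omega⟩
    · rcases hRmem u huR with rfl | h
      · exact hxP i (hAi _ hu)
      · exact hlik.disj u (hAi u hu) (hYk u h)
    · rcases hRmem v hv with rfl | h
      · exact .inr ⟨hA u hu huv.symm, rfl⟩
      · rcases hlik.cross u (hAi u hu) v (hYk v h) huv with h' | ⟨rfl, -⟩
        · exact .inl h'
        · exact (hbiA hu).elim
  have hAT : Linked G ℓ A T := by
    have hlen := hlij.le_length
    refine ⟨fun u hu huT => ?_, hlij.adj_start, hcd, fun u hu v hv huv => ?_, by omega,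
      by omega⟩
    · rcases hTmem u huT with h | h
      · exact hlij.disj u (hAi u hu) h
      · exact hADdisj u hu h
    · rcases hTmem v hv with h | h
      · rcases hlij.cross u (hAi u hu) v h huv with h' | ⟨rfl, -⟩
        · exact .inl h'
        · exact (hbiA hu).elim
      · exact .inr (hADcross u hu v h huv)
  have hRT : Linked G ℓ R T := by
    refine ⟨fun u hu huT => ?_, hljk.adj_start.symm, hxd, fun u hu v hv huv => ?_, by omega,
      by omega⟩
    · rcases hRmem u hu with rfl | hu <;> rcases hTmem u huT with h | h
      · exact hxP j h
      · exact hxP i (hDi _ h)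
      · exact hljk.disj u h (hYk u hu)
      · exact hlik.disj u (hDi u h) (hYk u hu)
    · rcases hRmem u hu with rfl | hu <;> rcases hTmem v hv with h | h
      · exact (hj v h huv).elim
      · exact .inr ⟨rfl, hD v h huv⟩
      · rcases hljk.cross v h u (hYk u hu) huv.symm with h' | ⟨-, rfl⟩
        · exact .inl h'.symm
        · exact (hbkY hu).elim
      · rcases hlik.cross v (hDi v h) u (hYk u hu) huv.symm with ⟨rfl, -⟩ | ⟨-, rfl⟩
        · exact (haiD h).elim
        · exact (hbkY hu).elim
  have hle := hsh.length_le hij hik hjk hAind hYx hjD hAR hAT hRT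
  omega

end prism

end LEH

open LEH

/-- a `K`-major vertex with no neighbours in `V(P j)` has either exactly one
neighbour, or two nonadjacent neighbours, in `V(P i)`. -/
theorem notwohat {V : Type*} [Fintype V]
    (ℓ : ℕ) (hℓ : 6 ≤ ℓ) (hℓeven : Even ℓ)
    (G : SimpleGraph V)
    {a b : Fin 3 → V} (P : ∀ i : Fin 3, G.Walk (a i) (b i))
    (hsh : ShortestLNP G ℓ P) (htidy : Tidy G ℓ P) :
    ∀ i j : Fin 3, i ≠ j → ∀ x : V, KMajor G P x →
      (∀ z ∈ (P j).support, ¬ G.Adj x z) →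
      ((∃! y, y ∈ (P i).support ∧ G.Adj x y) ∨
        ∃ y z, y ∈ (P i).support ∧ z ∈ (P i).support ∧ y ≠ z ∧
          G.Adj x y ∧ G.Adj x z ∧ ¬ G.Adj y z) := by
  intro i j hij x hx hj
  obtain ⟨k, hik, hjk, hcover⟩ := exists_third hij
  by_contra! hcon
  obtain ⟨huniq, hadj⟩ := hcon
  by_cases hi : ∀ z ∈ (P i).support, ¬ G.Adj x z
  · refine hx.not_confined hℓ hℓeven hsh htidy k fun m hm => ?_
    rcases hcover m with rfl | rfl | rfl
    exacts [hi, hj, (hm rfl).elim]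
  push Not at hi
  obtain ⟨c, A, B, hAB, hxc, hA⟩ := exists_first_neighbor x (P i) hi
  have hPi := (hsh.1.linked hij).2.1
  have hcP : c ∈ (P i).support := by
    rw [hAB, Walk.mem_support_append_iff]; exact .inl A.end_mem_support
  obtain ⟨d, hdP, hxd, hdc⟩ : ∃ d ∈ (P i).support, G.Adj x d ∧ d ≠ c := by
    by_contra! h
    exact huniq ⟨c, ⟨hcP, hxc⟩, fun z hz => h z hz.1 hz.2⟩
  have hBind : IsInducedPath B := IsInducedPath.of_append_right (hAB ▸ hPi)
  have hedge : ∀ z ∈ (P i).support, G.Adj x z → z ≠ c → s(c, z) ∈ B.edges := by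
    intro z hz hxz hzc
    have hzB : z ∈ B.support := by
      rw [hAB, Walk.mem_support_append_iff] at hz
      exact hz.resolve_left fun h => hzc (hA z h hxz)
    exact hBind.2 c B.start_mem_support z hzB (hadj c z hcP hz hzc.symm hxc hxz)
  cases B with
  | nil => simpa using hedge d hdP hxd hdc
  | @cons _ e _ hce D =>
    have hcD := ((Walk.cons_isPath_iff _ _).1 hBind.1).2
    have heq : ∀ z ∈ (P i).support, G.Adj x z → z ≠ c → z = e := by
      intro z hz hxz hzc
      rcases List.mem_cons.1 (Walk.edges_cons hce D ▸ hedge z hz hxz hzc) with h | h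
      · exact Sym2.congr_right.1 h
      · exact (hcD (Walk.fst_mem_support_of_mem_edges _ h)).elim
    obtain rfl := heq d hdP hxd hdc
    have hDP : ∀ z ∈ D.support, z ∈ (P i).support := by
      intro z hz
      rw [hAB, Walk.mem_support_append_iff]
      simp [hz]
    have hk : ∃ z ∈ (P k).support, G.Adj x z := by
      obtain ⟨m, z, hz, hxz, hzcd⟩ := hx.exists_notMem (Walk.cons hce .nil) i
        (by simp [hAB, Walk.edges_append]) (by simp [hce.ne]) (by simp)
      rcases hcover m with rfl | rfl | rfl
      · by_cases hzc : z = c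
        · simp [hzc] at hzcd
        · simp [heq z hz hxz hzc] at hzcd
      · exact (hj z hz hxz).elim
      · exact ⟨z, hz, hxz⟩
    exact hsh.not_consecutive hℓ hℓeven htidy hx.1 hij hik hjk hj hk hAB hxc hxd hA
      fun z hz hxz => heq z (hDP z hz) hxz (by rintro rfl; exact hcD hz)
end
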